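/- Every set P of n ≥ 3 points in ℝ² in general position has at most n − 3 unordered pairs {u,v} of points of P that are useful order-1 Delaunay edges but not Delaunay edges. -/

import Mathlib

open EuclideanGeometry Set

noncomputable section

/-- Points of the Euclidean plane. -/
abbrev Pt : Type := EuclideanSpace ℝ (Fin 2)

noncomputable instance : DecidableEq Pt := Classical.decEq _

/-- `P` is in general position: no three (distinct) points collinear and
no four (distinct) points concyclic. -/
def GenPos (P : Set Pt) : Prop :=
  (∀ u v w : Pt, u ∈ P → v ∈ P → w ∈ P → u ≠ v → u ≠ w → v ≠ w →
    ¬ Collinear ℝ ({u, v, w} : Set Pt)) ∧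
  (∀ u v w z : Pt, u ∈ P → v ∈ P → w ∈ P → z ∈ P →
    u ≠ v → u ≠ w → u ≠ z → v ≠ w → v ≠ z → w ≠ z →
    ¬ EuclideanGeometry.Cospherical ({u, v, w, z} : Set Pt))

/-- The (closed) triangle spanned by a finite set of points. -/
def triSet (t : Finset Pt) : Set Pt := convexHull ℝ (t : Set Pt)

/-- `T` is a triangulation of `P`: a finite set of triangles with vertices in `P`,
every point of `P` is a vertex of some triangle, the interiors of the triangles are
pairwise disjoint, and their union is the convex hull of `P`. -/
def IsTriangulation (P : Set Pt) (T : Set (Finset Pt)) : Prop :=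
  T.Finite ∧
  (∀ t ∈ T, t.card = 3 ∧ (t : Set Pt) ⊆ P) ∧
  (∀ p ∈ P, ∃ t ∈ T, p ∈ t) ∧
  (T.Pairwise fun t s => interior (triSet t) ∩ interior (triSet s) = ∅) ∧
  (⋃ t ∈ T, triSet t) = convexHull ℝ P

/-- The triangle `t` (with vertex set `t`) is order-`k` Delaunay with respect to `P`:
the open disk bounded by its circumcircle contains at most `k` points of `P`. -/
def OrderKTri (P : Set Pt) (k : ℕ) (t : Finset Pt) : Prop :=
  ∃ z : Pt, ∃ r : ℝ, (∀ p ∈ t, dist p z = r) ∧ {p ∈ P | dist p z < r}.encard ≤ (k : ℕ∞)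

/-- `T` is an order-`k` Delaunay triangulation of `P`. -/
def IsOrderDT (P : Set Pt) (k : ℕ) (T : Set (Finset Pt)) : Prop :=
  IsTriangulation P T ∧ ∀ t ∈ T, OrderKTri P k t

/-- `{u, v}` is an order-`k` Delaunay edge of `P`: some open disk having `u` and `v`
on its boundary circle contains at most `k` points of `P`. -/
def OrderKEdge (P : Set Pt) (k : ℕ) (u v : Pt) : Prop :=
  ∃ z : Pt, ∃ r : ℝ, dist u z = r ∧ dist v z = r ∧ {p ∈ P | dist p z < r}.encard ≤ (k : ℕ∞)

/-- `{u, v}` is a useful order-`k` Delaunay edge of `P`: some order-`k` Delaunay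
triangulation of `P` contains a triangle having `u` and `v` among its vertices
(i.e. having segment `uv` as a side). -/
def UsefulEdge (P : Set Pt) (k : ℕ) (u v : Pt) : Prop :=
  ∃ T, IsOrderDT P k T ∧ ∃ t ∈ T, u ∈ t ∧ v ∈ t

/-- `{u, v}` is a Delaunay edge: it is an edge of the (unique) order-0 Delaunay
triangulation of `P`. -/
def DelaunayEdge (P : Set Pt) (u v : Pt) : Prop := UsefulEdge P 0 u v

/-- `p` lies strictly to the left of the directed line from `v` to `u`, i.e. the
triple `v, u, p` makes a counterclockwise turn. -/
def ccw (v u p : Pt) : Prop :=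
  0 < (u 0 - v 0) * (p 1 - v 1) - (u 1 - v 1) * (p 0 - v 0)


/-- The set of unordered pairs of points of `P` that are useful order-1 Delaunay edges
but not Delaunay edges. -/
def usefulNotDel (P : Set Pt) : Set (Finset Pt) :=
  {e | ∃ u v : Pt, u ∈ P ∧ v ∈ P ∧ u ≠ v ∧ e = {u, v} ∧
    UsefulEdge P 1 u v ∧ ¬ DelaunayEdge P u v}

/-- Twice the signed area of the triangle `u v w`. -/
def orient (u v w : Pt) : ℝ :=
  (v 0 - u 0) * (w 1 - u 1) - (v 1 - u 1) * (w 0 - u 0)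

/-- The polynomial `|p|² - (c₁ p₀ + c₂ p₁ + c₃)`: the power of `p` with respect to a circle. -/
def pw (c : ℝ × ℝ × ℝ) (p : Pt) : ℝ :=
  p 0 ^ 2 + p 1 ^ 2 - (c.1 * p 0 + c.2.1 * p 1 + c.2.2)

/-- `p` has barycentric coordinates `α, β, γ` with respect to `u, v, w`. -/
structure Bary (u v w p : Pt) (α β γ : ℝ) : Prop where
  x : p 0 = α * u 0 + β * v 0 + γ * w 0
  y : p 1 = α * u 1 + β * v 1 + γ * w 1
  sum : α + β + γ = 1

lemma Pt.ext' {p q : Pt} (h0 : p 0 = q 0) (h1 : p 1 = q 1) : p = q := by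
  ext i; fin_cases i <;> assumption

lemma exists_bary {u v w : Pt} (h : orient u v w ≠ 0) (p : Pt) :
    Bary u v w p (orient p v w / orient u v w) (orient u p w / orient u v w)
      (orient u v p / orient u v w) := by
  constructor
  · field_simp; unfold orient; ring
  · field_simp; unfold orient; ring
  · field_simp; unfold orient; ring

namespace Bary

variable {u v w p : Pt} {α β γ : ℝ}

lemma rot (h : Bary u v w p α β γ) : Bary v w u p β γ α :=
  ⟨by rw [h.x]; ring, by rw [h.y]; ring, by linarith [h.sum]⟩

lemma swap (h : Bary u v w p α β γ) : Bary v u w p β α γ :=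
  ⟨by rw [h.x]; ring, by rw [h.y]; ring, by linarith [h.sum]⟩

lemma orient_left (h : Bary u v w p α β γ) : orient p v w = α * orient u v w := by
  have hs := h.sum
  obtain rfl : α = 1 - β - γ := by linarith
  unfold orient; rw [h.x, h.y]; ring

lemma orient_mid (h : Bary u v w p α β γ) : orient u p w = β * orient u v w := by
  have hs := h.sum
  obtain rfl : α = 1 - β - γ := by linarith
  unfold orient; rw [h.x, h.y]; ring

lemma orient_right (h : Bary u v w p α β γ) : orient u v p = γ * orient u v w := by
  have hs := h.sum
  obtain rfl : α = 1 - β - γ := by linarith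
  unfold orient; rw [h.x, h.y]; ring

lemma pw_sub (h : Bary u v w p α β γ) (c c' : ℝ × ℝ × ℝ) :
    pw c p - pw c' p = α * (pw c u - pw c' u) + β * (pw c v - pw c' v)
      + γ * (pw c w - pw c' w) := by
  have hs := h.sum
  obtain rfl : α = 1 - β - γ := by linarith
  unfold pw; rw [h.x, h.y]; ring

lemma pw_eq (h : Bary u v w p α β γ) (c : ℝ × ℝ × ℝ) :
    pw c p = α * pw c u + β * pw c v + γ * pw c w
      - (β * ((v 0 - u 0) ^ 2 + (v 1 - u 1) ^ 2) + γ * ((w 0 - u 0) ^ 2 + (w 1 - u 1) ^ 2)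
        - ((p 0 - u 0) ^ 2 + (p 1 - u 1) ^ 2)) := by
  have hs := h.sum
  obtain rfl : α = 1 - β - γ := by linarith
  unfold pw; rw [h.x, h.y]; ring

lemma pw_eq' (h : Bary u v w p α β γ) (c : ℝ × ℝ × ℝ) :
    pw c p = α * pw c u + β * pw c v + γ * pw c w
      - (α * β * ((v 0 - u 0) ^ 2 + (v 1 - u 1) ^ 2)
        + α * γ * ((w 0 - u 0) ^ 2 + (w 1 - u 1) ^ 2)
        + β * γ * ((v 0 - w 0) ^ 2 + (v 1 - w 1) ^ 2)) := by
  have hs := h.sum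
  obtain rfl : α = 1 - β - γ := by linarith
  unfold pw; rw [h.x, h.y]; ring

/-- The cone opposite to a triangle at a vertex does not meet the circumdisk. -/
lemma pw_nonneg_of_cone (h : Bary u v w p α β γ) {c : ℝ × ℝ × ℝ} (hu : pw c u = 0)
    (hv : pw c v = 0) (hw : pw c w = 0) (hβ : β ≤ 0) (hγ : γ ≤ 0) : 0 ≤ pw c p := by
  rw [h.pw_eq c, hu, hv, hw]
  have h1 := mul_nonneg (neg_nonneg.2 hβ)
    (add_nonneg (sq_nonneg (v 0 - u 0)) (sq_nonneg (v 1 - u 1)))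
  have h2 := mul_nonneg (neg_nonneg.2 hγ)
    (add_nonneg (sq_nonneg (w 0 - u 0)) (sq_nonneg (w 1 - u 1)))
  nlinarith [sq_nonneg (p 0 - u 0), sq_nonneg (p 1 - u 1)]

lemma pw_le (h : Bary u v w p α β γ) (c : ℝ × ℝ × ℝ) (hα : 0 ≤ α) (hβ : 0 ≤ β) (hγ : 0 ≤ γ) :
    pw c p ≤ α * pw c u + β * pw c v + γ * pw c w := by
  rw [h.pw_eq' c]
  have := mul_nonneg hα hβ
  have := mul_nonneg hα hγ
  have := mul_nonneg hβ hγ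
  have : 0 ≤ α * β * ((v 0 - u 0) ^ 2 + (v 1 - u 1) ^ 2)
        + α * γ * ((w 0 - u 0) ^ 2 + (w 1 - u 1) ^ 2)
        + β * γ * ((v 0 - w 0) ^ 2 + (v 1 - w 1) ^ 2) := by positivity
  linarith

end Bary

lemma exists_pw_eq_zero {u v w : Pt} (h : orient u v w ≠ 0) :
    ∃ c, pw c u = 0 ∧ pw c v = 0 ∧ pw c w = 0 := by
  set s : Pt → ℝ := fun p => p 0 ^ 2 + p 1 ^ 2 with hs
  set A := ((s v - s u) * (w 1 - u 1) - (s w - s u) * (v 1 - u 1)) / orient u v w with hA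
  set B := ((s w - s u) * (v 0 - u 0) - (s v - s u) * (w 0 - u 0)) / orient u v w with hB
  have e1 : A * (v 0 - u 0) + B * (v 1 - u 1) = s v - s u := by
    rw [hA, hB]; field_simp; unfold orient; ring
  have e2 : A * (w 0 - u 0) + B * (w 1 - u 1) = s w - s u := by
    rw [hA, hB]; field_simp; unfold orient; ring
  refine ⟨(A, B, s u - A * u 0 - B * u 1), ?_, ?_, ?_⟩ <;> simp only [pw, hs] at * <;> linarith

lemma dist_sq_eq (p z : Pt) : dist p z ^ 2 = (p 0 - z 0) ^ 2 + (p 1 - z 1) ^ 2 := by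
  rw [EuclideanSpace.dist_eq, Real.sq_sqrt (by positivity), Fin.sum_univ_two,
    Real.dist_eq, Real.dist_eq, sq_abs, sq_abs]

lemma pw_eq_dist (z : Pt) (r : ℝ) (p : Pt) :
    pw (2 * z 0, 2 * z 1, r ^ 2 - z 0 ^ 2 - z 1 ^ 2) p = dist p z ^ 2 - r ^ 2 := by
  rw [dist_sq_eq]; simp only [pw]; ring

lemma dist_sq_eq_pw (c : ℝ × ℝ × ℝ) (p : Pt) :
    dist p !₂[c.1 / 2, c.2.1 / 2] ^ 2 = pw c p + (c.2.2 + c.1 ^ 2 / 4 + c.2.1 ^ 2 / 4) := by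
  rw [dist_sq_eq]; simp [pw]; ring

lemma orderKTri_iff {P : Set Pt} {k : ℕ} {t : Finset Pt} (ht : t.Nonempty) :
    OrderKTri P k t ↔
      ∃ c, (∀ p ∈ t, pw c p = 0) ∧ {p ∈ P | pw c p < 0}.encard ≤ (k : ℕ∞) := by
  obtain ⟨a, ha⟩ := ht
  constructor
  · rintro ⟨z, r, h1, h2⟩
    have hr : 0 ≤ r := h1 a ha ▸ dist_nonneg
    refine ⟨(2 * z 0, 2 * z 1, r ^ 2 - z 0 ^ 2 - z 1 ^ 2), fun p hp => ?_, ?_⟩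
    · rw [pw_eq_dist, h1 p hp, sub_self]
    · convert h2 using 5 with p
      rw [pw_eq_dist, sub_neg, sq_lt_sq₀ dist_nonneg hr]
  · rintro ⟨c, h1, h2⟩
    have key : ∀ p, pw c p = dist p !₂[c.1 / 2, c.2.1 / 2] ^ 2
        - dist a !₂[c.1 / 2, c.2.1 / 2] ^ 2 := fun p => by
      rw [dist_sq_eq_pw, dist_sq_eq_pw, h1 a ha]; ring
    refine ⟨!₂[c.1 / 2, c.2.1 / 2], dist a !₂[c.1 / 2, c.2.1 / 2], fun p hp => ?_, ?_⟩
    · have := key p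
      rw [h1 p hp] at this
      exact (sq_eq_sq₀ dist_nonneg dist_nonneg).1 (by linarith)
    · convert h2 using 5 with p
      rw [key p, sub_neg, sq_lt_sq₀ dist_nonneg dist_nonneg]

lemma orient_ne_zero {P : Set Pt} (hgp : GenPos P) {u v w : Pt} (hu : u ∈ P) (hv : v ∈ P)
    (hw : w ∈ P) (huv : u ≠ v) (huw : u ≠ w) (hvw : v ≠ w) : orient u v w ≠ 0 := by
  intro h
  refine hgp.1 u v w hu hv hw huv huw hvw ?_
  rw [collinear_iff_of_mem (p₀ := u) (by simp)]
  refine ⟨v - u, fun p hp => ?_⟩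
  simp only [mem_insert_iff, mem_singleton_iff] at hp
  rcases hp with rfl | rfl | rfl
  · exact ⟨0, by simp⟩
  · exact ⟨1, by simp⟩
  · unfold orient at h
    by_cases h0 : v 0 - u 0 = 0
    · have h1 : v 1 - u 1 ≠ 0 := fun h1 => huv (Pt.ext' (by linarith) (by linarith))
      refine ⟨(p 1 - u 1) / (v 1 - u 1), Pt.ext' ?_ ?_⟩
      · simp only [vadd_eq_add, PiLp.add_apply, PiLp.smul_apply, PiLp.sub_apply, smul_eq_mul]
        field_simp; linarith
      · simp only [vadd_eq_add, PiLp.add_apply, PiLp.smul_apply, PiLp.sub_apply, smul_eq_mul]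
        field_simp; linarith
    · refine ⟨(p 0 - u 0) / (v 0 - u 0), Pt.ext' ?_ ?_⟩
      · simp only [vadd_eq_add, PiLp.add_apply, PiLp.smul_apply, PiLp.sub_apply, smul_eq_mul]
        field_simp; linarith
      · simp only [vadd_eq_add, PiLp.add_apply, PiLp.smul_apply, PiLp.sub_apply, smul_eq_mul]
        field_simp; linarith

lemma pw_ne_zero {P : Set Pt} (hgp : GenPos P) {u v w p : Pt} (hu : u ∈ P) (hv : v ∈ P)
    (hw : w ∈ P) (hp : p ∈ P) (huv : u ≠ v) (huw : u ≠ w) (hvw : v ≠ w) (hpu : p ≠ u)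
    (hpv : p ≠ v) (hpw : p ≠ w) {c : ℝ × ℝ × ℝ} (h1 : pw c u = 0) (h2 : pw c v = 0)
    (h3 : pw c w = 0) : pw c p ≠ 0 := by
  intro h4
  refine hgp.2 u v w p hu hv hw hp huv huw hpu.symm hvw hpv.symm hpw.symm
    ⟨!₂[c.1 / 2, c.2.1 / 2], Real.sqrt (c.2.2 + c.1 ^ 2 / 4 + c.2.1 ^ 2 / 4), ?_⟩
  have key : ∀ q, pw c q = 0 → dist q !₂[c.1 / 2, c.2.1 / 2]
      = Real.sqrt (c.2.2 + c.1 ^ 2 / 4 + c.2.1 ^ 2 / 4) := fun q hq => by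
    rw [← Real.sqrt_sq (dist_nonneg (x := q)), dist_sq_eq_pw, hq, zero_add]
  simp only [mem_insert_iff, mem_singleton_iff]
  rintro q (rfl | rfl | rfl | rfl) <;> apply key <;> assumption

lemma mem_triSet {u v w p : Pt} :
    p ∈ triSet {u, v, w} ↔ ∃ α β γ : ℝ, 0 ≤ α ∧ 0 ≤ β ∧ 0 ≤ γ ∧ Bary u v w p α β γ := by
  have hcoe : (({u, v, w} : Finset Pt) : Set Pt) = {u, v, w} := by simp
  rw [triSet, hcoe]
  constructor
  · intro hp
    refine convexHull_min (t := {p : Pt | ∃ α β γ : ℝ, 0 ≤ α ∧ 0 ≤ β ∧ 0 ≤ γ ∧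
      Bary u v w p α β γ}) ?_ ?_ hp
    · simp only [insert_subset_iff, singleton_subset_iff, mem_ofPred_eq]
      exact ⟨⟨1, 0, 0, by norm_num, le_rfl, le_rfl, by simp, by simp, by simp⟩,
        ⟨0, 1, 0, le_rfl, by norm_num, le_rfl, by simp, by simp, by simp⟩,
        ⟨0, 0, 1, le_rfl, le_rfl, by norm_num, by simp, by simp, by simp⟩⟩
    · rintro x ⟨α, β, γ, h1, h2, h3, h⟩ y ⟨α', β', γ', h1', h2', h3', h'⟩ a b ha hb hab
      refine ⟨a * α + b * α', a * β + b * β', a * γ + b * γ', by positivity, by positivity,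
        by positivity, ?_, ?_, ?_⟩
      · simp [h.x, h'.x]; ring
      · simp [h.y, h'.y]; ring
      · linear_combination a * h.sum + b * h'.sum + hab
  · rintro ⟨α, β, γ, h1, h2, h3, h⟩
    have hp : p = ∑ i : Fin 3, (![α, β, γ] i) • (![u, v, w] i) := by
      apply Pt.ext'
      · simp [Fin.sum_univ_three, h.x]
      · simp [Fin.sum_univ_three, h.y]
    rw [hp]
    refine (convex_convexHull ℝ _).sum_mem ?_ ?_ ?_
    · intro i _; fin_cases i <;> simpa
    · simpa [Fin.sum_univ_three] using h.sum
    · intro i _; apply subset_convexHull; fin_cases i <;> simp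

lemma continuous_orient {f g h : Pt → Pt} (hf : Continuous f) (hg : Continuous g)
    (hh : Continuous h) : Continuous fun p => orient (f p) (g p) (h p) := by
  unfold orient; fun_prop

lemma mem_interior_triSet {u v w p : Pt} {α β γ : ℝ} (h : Bary u v w p α β γ)
    (hα : 0 < α) (hβ : 0 < β) (hγ : 0 < γ) (h0 : orient u v w ≠ 0) :
    p ∈ interior (triSet {u, v, w}) := by
  rw [mem_interior]
  refine ⟨{p | 0 < orient p v w / orient u v w ∧ 0 < orient u p w / orient u v w ∧
    0 < orient u v p / orient u v w}, ?_, ?_, ?_⟩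
  · rintro x ⟨h1, h2, h3⟩
    exact mem_triSet.2 ⟨_, _, _, h1.le, h2.le, h3.le, exists_bary h0 x⟩
  · have h1 : Continuous fun p => orient p v w / orient u v w :=
      (continuous_orient continuous_id continuous_const continuous_const).div_const _
    have h2 : Continuous fun p => orient u p w / orient u v w :=
      (continuous_orient continuous_const continuous_id continuous_const).div_const _
    have h3 : Continuous fun p => orient u v p / orient u v w :=
      (continuous_orient continuous_const continuous_const continuous_id).div_const _
    exact (isOpen_lt continuous_const h1).inter
      ((isOpen_lt continuous_const h2).inter (isOpen_lt continuous_const h3))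
  · simp only [mem_ofPred_eq, h.orient_left, h.orient_mid, h.orient_right]
    field_simp
    exact ⟨hα, hβ, hγ⟩

lemma exists_centroid (u v w : Pt) : ∃ p, Bary u v w p (1 / 3) (1 / 3) (1 / 3) :=
  ⟨!₂[1 / 3 * u 0 + 1 / 3 * v 0 + 1 / 3 * w 0, 1 / 3 * u 1 + 1 / 3 * v 1 + 1 / 3 * w 1],
    by simp, by simp, by norm_num⟩

lemma interior_triSet_nonempty {u v w : Pt} (h0 : orient u v w ≠ 0) :
    (interior (triSet {u, v, w})).Nonempty := by
  obtain ⟨p, hp⟩ := exists_centroid u v w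
  exact ⟨p, mem_interior_triSet hp (by norm_num) (by norm_num) (by norm_num) h0⟩

lemma isClosed_triSet (t : Finset Pt) : IsClosed (triSet t) :=
  t.finite_toSet.isClosed_convexHull (𝕜 := ℝ)

lemma exists_eq_triple_of_mem {t : Finset Pt} (ht : t.card = 3) {u : Pt} (hu : u ∈ t) :
    ∃ v w, t = {u, v, w} ∧ u ≠ v ∧ u ≠ w ∧ v ≠ w := by
  have h2 : (t.erase u).card = 2 := by rw [Finset.card_erase_of_mem hu, ht]
  obtain ⟨v, w, hvw, h⟩ := Finset.card_eq_two.1 h2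
  have hv : v ∈ t.erase u := by rw [h]; simp
  have hw : w ∈ t.erase u := by rw [h]; simp
  refine ⟨v, w, ?_, (Finset.ne_of_mem_erase hv).symm, (Finset.ne_of_mem_erase hw).symm, hvw⟩
  rw [← Finset.insert_erase hu, h]

lemma exists_eq_triple_of_mem_of_mem {t : Finset Pt} (ht : t.card = 3) {u v : Pt} (hu : u ∈ t)
    (hv : v ∈ t) (huv : u ≠ v) : ∃ w, t = {u, v, w} ∧ u ≠ w ∧ v ≠ w := by
  obtain ⟨x, y, rfl, h1, h2, h3⟩ := exists_eq_triple_of_mem ht hu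
  simp only [Finset.mem_insert, Finset.mem_singleton] at hv
  rcases hv with rfl | rfl | rfl
  · exact absurd rfl huv
  · exact ⟨y, rfl, h2, h3⟩
  · exact ⟨x, by ext; simp only [Finset.mem_insert, Finset.mem_singleton]; tauto, h1, h3.symm⟩

lemma interior_inter_interior_nonempty {P : Set Pt} (hgp : GenPos P) {s : Finset Pt}
    (hs : s.card = 3) (hsP : (s : Set Pt) ⊆ P) {U : Set Pt} {x : Pt}
    (hx : x ∈ interior U) (hxs : x ∈ triSet s) :
    (interior U ∩ interior (triSet s)).Nonempty := by
  obtain ⟨u, v, w, huv, huw, hvw, rfl⟩ := Finset.card_eq_three.1 hs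
  simp only [Finset.coe_insert, Finset.coe_singleton, insert_subset_iff,
    singleton_subset_iff] at hsP
  have h0 := orient_ne_zero hgp hsP.1 hsP.2.1 hsP.2.2 huv huw hvw
  have hcl : x ∈ closure (interior (triSet {u, v, w})) := by
    have hconv : Convex ℝ (triSet {u, v, w}) := convex_convexHull ℝ _
    rw [hconv.closure_interior_eq_closure_of_nonempty_interior (interior_triSet_nonempty h0)]
    exact subset_closure hxs
  exact mem_closure_iff.1 hcl _ isOpen_interior hx

lemma IsTriangulation.eq_of_mem_interior {P : Set Pt} {T : Set (Finset Pt)} (hgp : GenPos P)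
    (hT : IsTriangulation P T) {s t : Finset Pt} (hs : s ∈ T) (ht : t ∈ T) {x : Pt}
    (hxt : x ∈ interior (triSet t)) (hxs : x ∈ triSet s) : t = s := by
  by_contra hne
  have := interior_inter_interior_nonempty hgp (hT.2.1 s hs).1 (hT.2.1 s hs).2 hxt hxs
  rw [hT.2.2.2.1 ht hs hne] at this
  exact this.ne_empty rfl

lemma IsTriangulation.mem_of_mem_triSet {P : Set Pt} {T : Set (Finset Pt)} (hgp : GenPos P)
    (hT : IsTriangulation P T) {s : Finset Pt} (hs : s ∈ T) {q : Pt} (hq : q ∈ P)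
    (hqs : q ∈ triSet s) : q ∈ s := by
  by_contra hn
  obtain ⟨t, ht, hqt⟩ := hT.2.2.1 q hq
  have hsc := hT.2.1 s hs
  obtain ⟨u, v, w, huv, huw, hvw, rfl⟩ := Finset.card_eq_three.1 hsc.1
  have hsP := hsc.2
  simp only [Finset.coe_insert, Finset.coe_singleton, insert_subset_iff,
    singleton_subset_iff] at hsP
  simp only [Finset.mem_insert, Finset.mem_singleton, not_or] at hn
  obtain ⟨hu, hv, hw⟩ := hsP
  have h0 := orient_ne_zero hgp hu hv hw huv huw hvw
  obtain ⟨α, β, γ, h1, h2, h3, hb⟩ := mem_triSet.1 hqs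
  have e1 := orient_ne_zero hgp hq hv hw hn.2.1 hn.2.2 hvw
  have e2 := orient_ne_zero hgp hu hq hw (Ne.symm hn.1) huw hn.2.2
  have e3 := orient_ne_zero hgp hu hv hq huv (Ne.symm hn.1) (Ne.symm hn.2.1)
  rw [hb.orient_left] at e1
  rw [hb.orient_mid] at e2
  rw [hb.orient_right] at e3
  have hinterior := mem_interior_triSet hb (h1.lt_of_ne' (left_ne_zero_of_mul e1))
    (h2.lt_of_ne' (left_ne_zero_of_mul e2)) (h3.lt_of_ne' (left_ne_zero_of_mul e3)) h0
  have := hT.eq_of_mem_interior hgp ht hs hinterior (subset_convexHull ℝ _ hqt)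
  subst this
  simp only [Finset.mem_insert, Finset.mem_singleton] at hqt
  tauto

open Filter Topology in
/-- Some triangle at the vertex `q` contains an initial piece of the segment from `q` to `z`. -/
lemma IsTriangulation.exists_mem_segment {P : Set Pt} {T : Set (Finset Pt)} (hgp : GenPos P)
    (hT : IsTriangulation P T) {q z : Pt} (hq : q ∈ P) (hz : z ∈ convexHull ℝ P) :
    ∃ s ∈ T, q ∈ s ∧ ∃ ε : ℝ, 0 < ε ∧ q + ε • (z - q) ∈ triSet s := by
  have hfreq : ∃ s ∈ T, ∃ᶠ ε : ℝ in 𝓝[>] 0, q + ε • (z - q) ∈ triSet s := by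
    by_contra! hcon
    have h1 : ∀ᶠ ε : ℝ in 𝓝[>] 0, ∀ s ∈ T, q + ε • (z - q) ∉ triSet s :=
      (Filter.eventually_all_finite hT.1).2 fun s hs => hcon s hs
    have h2 : ∀ᶠ ε : ℝ in 𝓝[>] 0, ε ∈ Ioc (0 : ℝ) 1 := Ioc_mem_nhdsGT one_pos
    obtain ⟨ε, h1, h2⟩ := (h1.and h2).exists
    have hmem : q + ε • (z - q) ∈ convexHull ℝ P :=
      (convex_convexHull ℝ P).add_smul_sub_mem (subset_convexHull ℝ P hq) hz ⟨h2.1.le, h2.2⟩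
    rw [← hT.2.2.2.2] at hmem
    simp only [mem_iUnion] at hmem
    obtain ⟨s, hs, hmem⟩ := hmem
    exact h1 s hs hmem
  obtain ⟨s, hs, hf⟩ := hfreq
  refine ⟨s, hs, ?_, ?_⟩
  · refine hT.mem_of_mem_triSet hgp hs hq ?_
    refine (isClosed_triSet s).mem_of_frequently_of_tendsto hf ?_
    have : Tendsto (fun ε : ℝ => q + ε • (z - q)) (𝓝 0) (𝓝 (q + (0 : ℝ) • (z - q))) :=
      Continuous.tendsto (by fun_prop) 0
    rw [zero_smul, add_zero] at this
    exact this.mono_left nhdsWithin_le_nhds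
  · obtain ⟨ε, h1, h2⟩ := (hf.and_eventually self_mem_nhdsWithin).exists
    exact ⟨ε, h2, h1⟩

/-- `t` is a triangle of the Delaunay triangulation of `P`. -/
def IsDel (P : Set Pt) (t : Finset Pt) : Prop :=
  t.card = 3 ∧ (t : Set Pt) ⊆ P ∧ ∃ c, (∀ p ∈ t, pw c p = 0) ∧ ∀ p ∈ P, 0 ≤ pw c p

lemma IsDel.orderKTri {P : Set Pt} {t : Finset Pt} (h : IsDel P t) : OrderKTri P 0 t := by
  obtain ⟨h3, -, c, h1, h2⟩ := h
  refine (orderKTri_iff (Finset.card_pos.1 (by omega))).2 ⟨c, h1, ?_⟩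
  simp only [Nat.cast_zero, nonpos_iff_eq_zero, encard_eq_zero]
  ext p
  simp only [mem_ofPred_eq, mem_empty_iff_false, iff_false, not_and, not_lt]
  exact h2 p

lemma pw_pos_of_notMem {P : Set Pt} (hgp : GenPos P) {t : Finset Pt} (h3 : t.card = 3)
    (htP : (t : Set Pt) ⊆ P) {c : ℝ × ℝ × ℝ} (hc : ∀ p ∈ t, pw c p = 0) {p : Pt} (hp : p ∈ P)
    (hpt : p ∉ t) (h : 0 ≤ pw c p) : 0 < pw c p := by
  refine h.lt_of_ne' ?_
  obtain ⟨u, v, w, huv, huw, hvw, rfl⟩ := Finset.card_eq_three.1 h3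
  simp only [Finset.mem_insert, Finset.mem_singleton, not_or] at hpt
  exact pw_ne_zero hgp (htP (by simp)) (htP (by simp)) (htP (by simp)) hp huv huw hvw hpt.1
    hpt.2.1 hpt.2.2 (hc u (by simp)) (hc v (by simp)) (hc w (by simp))

lemma IsDel.eq_of_bary_pos {P : Set Pt} (hgp : GenPos P) {s t : Finset Pt} (ht : IsDel P t)
    (hs : IsDel P s) {u v w x : Pt} {α β γ : ℝ} (htu : t = {u, v, w})
    (hx : Bary u v w x α β γ) (hα : 0 < α) (hβ : 0 < β) (hγ : 0 < γ) (hxs : x ∈ triSet s) :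
    t = s := by
  obtain ⟨h3, htP, c, hc, hcP⟩ := ht
  obtain ⟨h3', hsP, c', hc', hcP'⟩ := hs
  obtain ⟨a, b, d, -, -, -, rfl⟩ := Finset.card_eq_three.1 h3'
  obtain ⟨α', β', γ', h1, h2, h4, hx'⟩ := mem_triSet.1 hxs
  have e1 := hx.pw_sub c' c
  have e2 := hx'.pw_sub c c'
  have hut : u ∈ t := by simp [htu]
  have hvt : v ∈ t := by simp [htu]
  have hwt : w ∈ t := by simp [htu]
  rw [hc u hut, hc v hvt, hc w hwt] at e1
  rw [hc' a (by simp), hc' b (by simp), hc' d (by simp)] at e2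
  have i1 := mul_nonneg h1 (hcP a (hsP (by simp)))
  have i2 := mul_nonneg h2 (hcP b (hsP (by simp)))
  have i3 := mul_nonneg h4 (hcP d (hsP (by simp)))
  have j1 := mul_nonneg hα.le (hcP' u (htP hut))
  have j2 := mul_nonneg hβ.le (hcP' v (htP hvt))
  have j3 := mul_nonneg hγ.le (hcP' w (htP hwt))
  have hsub : ∀ p ∈ t, pw c' p = 0 := by
    rw [htu]
    simp only [Finset.mem_insert, Finset.mem_singleton]
    rintro p (rfl | rfl | rfl)
    · exact (mul_eq_zero.1 (by linarith : α * pw c' p = 0)).resolve_left hα.ne'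
    · exact (mul_eq_zero.1 (by linarith : β * pw c' p = 0)).resolve_left hβ.ne'
    · exact (mul_eq_zero.1 (by linarith : γ * pw c' p = 0)).resolve_left hγ.ne'
  refine Finset.eq_of_subset_of_card_le (fun p hp => ?_) (by omega)
  by_contra hn
  exact (pw_pos_of_notMem hgp h3' hsP hc' (htP hp) hn (hcP' p (htP hp))).ne' (hsub p hp)

/-- Moving from a point in the open positive orthant against a direction with positive
coordinate sum, one hits a coordinate hyperplane. -/
lemma exists_exit_time (ξ α : Fin 3 → ℝ) (hξ : ∀ i, 0 < ξ i) (hα : α 0 + α 1 + α 2 = 1) :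
    ∃ θ : ℝ, 0 < θ ∧ (∀ i, 0 ≤ ξ i - θ * α i) ∧ ∃ i, ξ i - θ * α i = 0 := by
  have hne : (Finset.univ.filter fun i => 0 < α i).Nonempty := by
    by_contra hcon
    rw [Finset.not_nonempty_iff_eq_empty, Finset.filter_eq_empty_iff] at hcon
    have h0 := hcon (Finset.mem_univ 0)
    have h1 := hcon (Finset.mem_univ 1)
    have h2 := hcon (Finset.mem_univ 2)
    linarith
  obtain ⟨i, hi, hmin⟩ := Finset.exists_min_image _ (fun i => ξ i / α i) hne
  simp only [Finset.mem_filter, Finset.mem_univ, true_and] at hi hmin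
  refine ⟨ξ i / α i, div_pos (hξ i) hi, fun j => ?_, i, ?_⟩
  · rcases le_or_gt (α j) 0 with h | h
    · have := mul_nonpos_of_nonneg_of_nonpos (div_pos (hξ i) hi).le h
      linarith [hξ j]
    · have := hmin j h
      rw [le_div_iff₀ h] at this
      linarith
  · field_simp; ring

lemma exists_triple_mem_triSet {P : Set Pt} (hfin : P.Finite) (h3 : 3 ≤ P.ncard) {x : Pt}
    (hx : x ∈ convexHull ℝ P) : ∃ t : Finset Pt, t.card = 3 ∧ (t : Set Pt) ⊆ P ∧ x ∈ triSet t := by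
  rw [convexHull_eq_union] at hx
  simp only [mem_iUnion] at hx
  obtain ⟨t, htP, hai, hxt⟩ := hx
  have hc : t.card ≤ 3 := by
    have := hai.card_le_finrank_succ
    simp only [Fintype.card_coe] at this
    have h2 := Submodule.finrank_le (vectorSpan ℝ (Set.range ((↑) : t → Pt)))
    rw [finrank_euclideanSpace, Fintype.card_fin] at h2
    omega
  rw [ncard_eq_toFinset_card P hfin] at h3
  obtain ⟨s, hts, hsP, hs⟩ := Finset.exists_subsuperset_card_eq
    (fun p hp => hfin.mem_toFinset.2 (htP hp) : t ⊆ hfin.toFinset) hc h3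
  exact ⟨s, hs, fun p hp => hfin.mem_toFinset.1 (hsP hp),
    convexHull_mono (Finset.coe_subset.2 hts) hxt⟩

lemma exists_isDel_of_generic {P : Set Pt} (hfin : P.Finite) (hgp : GenPos P) (h3 : 3 ≤ P.ncard)
    {x : Pt} (hx : x ∈ convexHull ℝ P)
    (hgen : ∀ u ∈ P, ∀ v ∈ P, u ≠ v → orient u v x ≠ 0) : ∃ t, IsDel P t ∧ x ∈ triSet t := by
  classical
  set S := (hfin.toFinset.powersetCard 3).filter fun t => x ∈ triSet t with hS
  have hmem : ∀ t, t ∈ S ↔ t.card = 3 ∧ (t : Set Pt) ⊆ P ∧ x ∈ triSet t := fun t => by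
    simp only [hS, Finset.mem_filter, Finset.mem_powersetCard, Set.Finite.subset_toFinset]
    tauto
  have hcirc : ∀ t, ∃ c, t ∈ S → ∀ p ∈ t, pw c p = 0 := fun t => by
    by_cases ht : t ∈ S
    · obtain ⟨h1, h2, -⟩ := (hmem t).1 ht
      obtain ⟨u, v, w, huv, huw, hvw, rfl⟩ := Finset.card_eq_three.1 h1
      obtain ⟨c, hu, hv, hw⟩ := exists_pw_eq_zero (orient_ne_zero hgp (h2 (by simp))
        (h2 (by simp)) (h2 (by simp)) huv huw hvw)
      refine ⟨c, fun _ => ?_⟩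
      simp only [Finset.mem_insert, Finset.mem_singleton]
      rintro p (rfl | rfl | rfl) <;> assumption
    · exact ⟨0, fun h => absurd h ht⟩
  choose c hc using hcirc
  obtain ⟨t₀, ht₀⟩ := exists_triple_mem_triSet hfin h3 hx
  obtain ⟨t, htS, hmax⟩ := Finset.exists_max_image S (fun t => pw (c t) x)
    ⟨t₀, (hmem t₀).2 ht₀⟩
  obtain ⟨ht3, htP, hxt⟩ := (hmem t).1 htS
  refine ⟨t, ⟨ht3, htP, c t, hc t htS, fun p hp => ?_⟩, hxt⟩
  by_contra! hneg
  have hpt : p ∉ t := fun h => hneg.ne (hc t htS p h)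
  have key : ∀ u v w : Pt, ∀ ξ₁ ξ₂ ξ₃ α₁ α₂ α₃ θ : ℝ, t = {u, v, w} → v ≠ w →
      Bary u v w x ξ₁ ξ₂ ξ₃ → Bary u v w p α₁ α₂ α₃ → 0 < θ → ξ₁ - θ * α₁ = 0 →
      0 ≤ ξ₂ - θ * α₂ → 0 ≤ ξ₃ - θ * α₃ → False := by
    intro u v w ξ₁ ξ₂ ξ₃ α₁ α₂ α₃ θ htu hvw hbx hbp hθ e1 e2 e3
    have hb : Bary v w p x (ξ₂ - θ * α₂) (ξ₃ - θ * α₃) θ := by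
      refine ⟨?_, ?_, ?_⟩
      · rw [hbx.x, hbp.x]; linear_combination u 0 * e1
      · rw [hbx.y, hbp.y]; linear_combination u 1 * e1
      · linear_combination hbx.sum - θ * hbp.sum - e1
    have hv : v ∈ t := by simp [htu]
    have hw : w ∈ t := by simp [htu]
    have hpv : v ≠ p := fun h => hpt (h ▸ hv)
    have hpw : w ≠ p := fun h => hpt (h ▸ hw)
    have hs : ({v, w, p} : Finset Pt) ∈ S := by
      refine (hmem _).2 ⟨Finset.card_eq_three.2 ⟨v, w, p, hvw, hpv, hpw, rfl⟩, ?_,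
        mem_triSet.2 ⟨_, _, _, e2, e3, hθ.le, hb⟩⟩
      simp [insert_subset_iff, htP hv, htP hw, hp]
    have h1 := hmax _ hs
    have h2 := hb.pw_sub (c {v, w, p}) (c t)
    rw [hc _ hs v (by simp), hc _ hs w (by simp), hc _ hs p (by simp), hc t htS v hv,
      hc t htS w hw] at h2
    have := mul_pos_of_neg_of_neg (neg_neg_of_pos hθ) hneg
    linarith
  obtain ⟨u, v, w, huv, huw, hvw, htu⟩ := Finset.card_eq_three.1 ht3
  have hu : u ∈ P := htP (by simp [htu])
  have hv : v ∈ P := htP (by simp [htu])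
  have hw : w ∈ P := htP (by simp [htu])
  have h0 := orient_ne_zero hgp hu hv hw huv huw hvw
  rw [htu] at hxt
  obtain ⟨ξ₁, ξ₂, ξ₃, hξ₁, hξ₂, hξ₃, hbx⟩ := mem_triSet.1 hxt
  have hbp := exists_bary h0 p
  set α₁ := orient p v w / orient u v w
  set α₂ := orient u p w / orient u v w
  set α₃ := orient u v p / orient u v w
  have g1 := hgen v hv w hw hvw
  have g2 := hgen w hw u hu huw.symm
  have g3 := hgen u hu v hv huv
  rw [hbx.rot.orient_right] at g1
  rw [hbx.rot.rot.orient_right] at g2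
  rw [hbx.orient_right] at g3
  obtain ⟨θ, hθ, hnn, i, hi⟩ := exists_exit_time ![ξ₁, ξ₂, ξ₃] ![α₁, α₂, α₃]
    (fun i => by
      fin_cases i
      · exact hξ₁.lt_of_ne' (left_ne_zero_of_mul g1)
      · exact hξ₂.lt_of_ne' (left_ne_zero_of_mul g2)
      · exact hξ₃.lt_of_ne' (left_ne_zero_of_mul g3)) hbp.sum
  have n0 : 0 ≤ ξ₁ - θ * α₁ := hnn 0
  have n1 : 0 ≤ ξ₂ - θ * α₂ := hnn 1
  have n2 : 0 ≤ ξ₃ - θ * α₃ := hnn 2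
  have perm1 : t = {v, w, u} := by rw [htu]; ext; simp; tauto
  have perm2 : t = {w, u, v} := by rw [htu]; ext; simp; tauto
  fin_cases i
  · exact key u v w _ _ _ _ _ _ θ htu hvw hbx hbp hθ hi n1 n2
  · exact key v w u _ _ _ _ _ _ θ perm1 huw.symm hbx.rot hbp.rot hθ hi n2 n0
  · exact key w u v _ _ _ _ _ _ θ perm2 huv hbx.rot.rot hbp.rot.rot hθ hi n0 n1

open Filter Topology in
lemma dense_orient_ne_zero {u v : Pt} (h : u ≠ v) : Dense {x | orient u v x ≠ 0} := by
  intro x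
  by_cases hx : orient u v x = 0
  · set n : Pt := !₂[-(v 1 - u 1), v 0 - u 0]
    have hn : ∀ ε : ℝ, orient u v (x + ε • n) =
        orient u v x + ε * ((v 0 - u 0) ^ 2 + (v 1 - u 1) ^ 2) := fun ε => by
      unfold orient; simp [n]; ring
    have hpos : (v 0 - u 0) ^ 2 + (v 1 - u 1) ^ 2 ≠ 0 := fun h0 => by
      have h1 : v 0 - u 0 = 0 := by nlinarith [sq_nonneg (v 0 - u 0), sq_nonneg (v 1 - u 1)]
      have h2 : v 1 - u 1 = 0 := by nlinarith [sq_nonneg (v 0 - u 0), sq_nonneg (v 1 - u 1)]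
      exact h (Pt.ext' (by linarith) (by linarith))
    have ht : Tendsto (fun ε : ℝ => x + ε • n) (𝓝[>] 0) (𝓝 x) := by
      have : Tendsto (fun ε : ℝ => x + ε • n) (𝓝 0) (𝓝 (x + (0 : ℝ) • n)) :=
        Continuous.tendsto (by fun_prop) 0
      rw [zero_smul, add_zero] at this
      exact this.mono_left nhdsWithin_le_nhds
    refine mem_closure_of_tendsto ht ?_
    filter_upwards [self_mem_nhdsWithin] with ε hε
    rw [hn, hx, zero_add]
    exact mul_ne_zero (ne_of_gt hε) hpos
  · exact subset_closure hx

lemma dense_generic {P : Set Pt} (hfin : P.Finite) :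
    Dense {x | ∀ u ∈ P, ∀ v ∈ P, u ≠ v → orient u v x ≠ 0} := by
  have h := dense_biInter_of_isOpen (S := {q : Pt × Pt | q.1 ∈ P ∧ q.2 ∈ P ∧ q.1 ≠ q.2})
    (f := fun q => {x | orient q.1 q.2 x ≠ 0})
    (fun q _ => isOpen_ne_fun
      (continuous_orient continuous_const continuous_const continuous_id) continuous_const)
    ((hfin.prod hfin).subset fun q hq => ⟨hq.1, hq.2.1⟩).countable
    (fun q hq => dense_orient_ne_zero hq.2.2)
  refine h.mono fun x hx u hu v hv huv => ?_
  exact mem_iInter₂.1 hx (u, v) ⟨hu, hv, huv⟩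

lemma finite_isDel {P : Set Pt} (hfin : P.Finite) : {t | IsDel P t}.Finite := by
  refine (hfin.toFinset.powerset.finite_toSet).subset fun t ht => ?_
  simpa using ht.2.1

lemma biUnion_isDel {P : Set Pt} (hfin : P.Finite) (hgp : GenPos P) (h3 : 3 ≤ P.ncard) :
    ⋃ t ∈ {t | IsDel P t}, triSet t = convexHull ℝ P := by
  refine subset_antisymm (iUnion₂_subset fun t ht => convexHull_mono ht.2.1) ?_
  have hcl : IsClosed (⋃ t ∈ {t | IsDel P t}, triSet t) :=
    (finite_isDel hfin).isClosed_biUnion fun t _ => isClosed_triSet t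
  have hsub : interior (convexHull ℝ P) ⊆ ⋃ t ∈ {t | IsDel P t}, triSet t := by
    refine ((dense_generic hfin).open_subset_closure_inter isOpen_interior).trans ?_
    refine hcl.closure_subset_iff.2 fun x hx => ?_
    obtain ⟨t, ht, hxt⟩ := exists_isDel_of_generic hfin hgp h3 (interior_subset hx.1) hx.2
    exact mem_iUnion₂.2 ⟨t, ht, hxt⟩
  have hne : (interior (convexHull ℝ P)).Nonempty := by
    rw [ncard_eq_toFinset_card P hfin] at h3
    obtain ⟨t, htP, ht⟩ := Finset.exists_subset_card_eq h3
    obtain ⟨u, v, w, huv, huw, hvw, rfl⟩ := Finset.card_eq_three.1 ht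
    have hsub : (({u, v, w} : Finset Pt) : Set Pt) ⊆ P := fun p hp =>
      hfin.mem_toFinset.1 (htP hp)
    exact (interior_triSet_nonempty (orient_ne_zero hgp (hsub (by simp)) (hsub (by simp))
      (hsub (by simp)) huv huw hvw)).mono (interior_mono (convexHull_mono hsub))
  calc convexHull ℝ P ⊆ closure (convexHull ℝ P) := subset_closure
    _ = closure (interior (convexHull ℝ P)) :=
      ((convex_convexHull ℝ P).closure_interior_eq_closure_of_nonempty_interior hne).symm
    _ ⊆ _ := hcl.closure_subset_iff.2 hsub

lemma isOrderDT_isDel {P : Set Pt} (hfin : P.Finite) (hgp : GenPos P) (h3 : 3 ≤ P.ncard) :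
    IsOrderDT P 0 {t | IsDel P t} := by
  refine ⟨⟨finite_isDel hfin, fun t ht => ⟨ht.1, ht.2.1⟩, fun p hp => ?_, ?_,
    biUnion_isDel hfin hgp h3⟩, fun t ht => ht.orderKTri⟩
  · have hmem := subset_convexHull ℝ P hp
    rw [← biUnion_isDel hfin hgp h3] at hmem
    obtain ⟨t, ht, hpt⟩ := mem_iUnion₂.1 hmem
    refine ⟨t, ht, ?_⟩
    by_contra hn
    obtain ⟨ht3, htP, c, hc, hcP⟩ := ht
    have hpos := pw_pos_of_notMem hgp ht3 htP hc hp hn (hcP p hp)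
    obtain ⟨u, v, w, -, -, -, rfl⟩ := Finset.card_eq_three.1 ht3
    obtain ⟨α, β, γ, h1, h2, h4, hb⟩ := mem_triSet.1 hpt
    have := hb.pw_le c h1 h2 h4
    rw [hc u (by simp), hc v (by simp), hc w (by simp)] at this
    linarith
  · intro t ht s hs hne
    by_contra hcon
    obtain ⟨x, hx, hgen⟩ := (dense_generic hfin).inter_open_nonempty _
      (isOpen_interior.inter isOpen_interior) (nonempty_iff_ne_empty.2 hcon)
    have hxt := interior_subset hx.1
    obtain ⟨u, v, w, huv, huw, hvw, htu⟩ := Finset.card_eq_three.1 ht.1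
    have hu : u ∈ P := ht.2.1 (by simp [htu])
    have hv : v ∈ P := ht.2.1 (by simp [htu])
    have hw : w ∈ P := ht.2.1 (by simp [htu])
    rw [htu] at hxt
    obtain ⟨α, β, γ, h1, h2, h4, hb⟩ := mem_triSet.1 hxt
    have g1 := hgen v hv w hw hvw
    have g2 := hgen w hw u hu huw.symm
    have g3 := hgen u hu v hv huv
    rw [hb.rot.orient_right] at g1
    rw [hb.rot.rot.orient_right] at g2
    rw [hb.orient_right] at g3
    exact hne (ht.eq_of_bary_pos hgp hs htu hb (h1.lt_of_ne' (left_ne_zero_of_mul g1))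
      (h2.lt_of_ne' (left_ne_zero_of_mul g2)) (h4.lt_of_ne' (left_ne_zero_of_mul g3))
      (interior_subset hx.2))

/-- The linear functional with coefficients `1` and `c`. -/
def lin (c : ℝ) (p : Pt) : ℝ := p 0 + c * p 1

lemma exists_injOn_lin {P : Set Pt} (hfin : P.Finite) : ∃ c, InjOn (lin c) P := by
  obtain ⟨c, hc⟩ := ((hfin.prod hfin).image
    fun q : Pt × Pt => -(q.1 0 - q.2 0) / (q.1 1 - q.2 1)).exists_notMem
  refine ⟨c, fun u hu v hv huv => ?_⟩
  unfold lin at huv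
  by_cases h : u 1 - v 1 = 0
  · have h1 : u 1 = v 1 := by linarith
    exact Pt.ext' (by rw [h1] at huv; linarith) h1
  · refine absurd ⟨(u, v), ⟨hu, hv⟩, ?_⟩ hc
    simp only
    field_simp
    linarith

/-- The triangle `t` has `m` as its middle vertex in the order given by `lin c`, and `σ` has the
sign that tells on which side of `m` the opposite edge passes. -/
def HasMid (c : ℝ) (t : Finset Pt) (q : Pt × ℝ) : Prop :=
  ∃ l r, t = {l, q.1, r} ∧ lin c l < lin c q.1 ∧ lin c q.1 < lin c r ∧ 0 < q.2 * orient l r q.1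

lemma bary_near_mid {c σ τ : ℝ} {l m r : Pt} (hl : lin c l < lin c m) (hr : lin c m < lin c r)
    (hσ : 0 < σ * orient l r m) (hτ : 0 < τ)
    (hτ1 : τ * (σ * (lin c r - lin c l) / orient l r m) < 1) :
    ∃ α β γ : ℝ, 0 < α ∧ 0 < β ∧ 0 < γ ∧
      Bary l m r !₂[m 0 + σ * τ * c, m 1 - σ * τ] α β γ := by
  have ho : orient l r m ≠ 0 := right_ne_zero_of_mul hσ.ne'
  have hq : 0 < σ / orient l r m := by
    have : σ / orient l r m = σ * orient l r m / orient l r m ^ 2 := by field_simp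
    rw [this]; positivity
  refine ⟨τ * (σ / orient l r m) * (lin c r - lin c m),
    1 - τ * (σ * (lin c r - lin c l) / orient l r m),
    τ * (σ / orient l r m) * (lin c m - lin c l),
    mul_pos (mul_pos hτ hq) (sub_pos.2 hr), sub_pos.2 hτ1,
    mul_pos (mul_pos hτ hq) (sub_pos.2 hl), ?_, ?_, ?_⟩
  · simp only [Matrix.cons_val_zero]
    field_simp
    unfold orient lin; ring
  · simp only [Matrix.cons_val_one, Matrix.cons_val_zero]
    field_simp
    unfold orient lin; ring
  · field_simp; ring

lemma IsDel.eq_of_hasMid {P : Set Pt} (hgp : GenPos P) {s t : Finset Pt} (ht : IsDel P t)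
    (hs : IsDel P s) {c : ℝ} {q : Pt × ℝ} (hqt : HasMid c t q) (hqs : HasMid c s q) : t = s := by
  obtain ⟨m, σ⟩ := q
  obtain ⟨l, r, htu, hl, hr, hσ⟩ := hqt
  obtain ⟨l', r', rfl, hl', hr', hσ'⟩ := hqs
  simp only at hl hr hσ hl' hr' hσ' htu
  set K := σ * (lin c r - lin c l) / orient l r m with hK
  set K' := σ * (lin c r' - lin c l') / orient l' r' m with hK'
  have hpos : 0 < 1 + |K| + |K'| := by positivity
  have hτ : 0 < 1 / (1 + |K| + |K'|) := by positivity
  have h1 : 1 / (1 + |K| + |K'|) * K < 1 := by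
    rw [one_div_mul_eq_div, div_lt_one hpos]
    linarith [le_abs_self K, abs_nonneg K']
  have h2 : 1 / (1 + |K| + |K'|) * K' < 1 := by
    rw [one_div_mul_eq_div, div_lt_one hpos]
    linarith [le_abs_self K', abs_nonneg K]
  obtain ⟨α, β, γ, hα, hβ, hγ, hb⟩ := bary_near_mid hl hr hσ hτ h1
  obtain ⟨α', β', γ', hα', hβ', hγ', hb'⟩ := bary_near_mid hl' hr' hσ' hτ h2
  exact ht.eq_of_bary_pos hgp hs htu hb hα hβ hγ
    (mem_triSet.2 ⟨_, _, _, hα'.le, hβ'.le, hγ'.le, hb'⟩)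

lemma exists_sorted {f : Pt → ℝ} {t : Finset Pt} (ht : t.card = 3) (hf : InjOn f t) :
    ∃ l m r, t = {l, m, r} ∧ f l < f m ∧ f m < f r := by
  obtain ⟨u, v, w, huv, huw, hvw, rfl⟩ := Finset.card_eq_three.1 ht
  have h1 : f u ≠ f v := fun h => huv (hf (by simp) (by simp) h)
  have h2 : f u ≠ f w := fun h => huw (hf (by simp) (by simp) h)
  have h3 : f v ≠ f w := fun h => hvw (hf (by simp) (by simp) h)
  rcases h1.lt_or_gt with h1 | h1 <;> rcases h2.lt_or_gt with h2 | h2 <;>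
    rcases h3.lt_or_gt with h3 | h3
  · exact ⟨u, v, w, rfl, h1, h3⟩
  · exact ⟨u, w, v, by ext; simp; tauto, h2, h3⟩
  · exact absurd (h1.trans h3) h2.not_gt
  · exact ⟨w, u, v, by ext; simp; tauto, h2, h1⟩
  · exact ⟨v, u, w, by ext; simp; tauto, h1, h2⟩
  · exact absurd (h2.trans h3) h1.not_gt
  · exact ⟨v, w, u, by ext; simp; tauto, h3, h2⟩
  · exact ⟨w, v, u, by ext; simp; tauto, h3, h1⟩

/-- A point of `P` that is extreme in the direction normal to `l₀ r₀` has no triangle on the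
extreme side. -/
lemma orient_nonpos_of_extreme {c σ : ℝ} {l₀ r₀ l m r : Pt} (h0 : lin c l₀ < lin c r₀)
    (hl : lin c l < lin c m) (hr : lin c m < lin c r)
    (hml : σ * orient l₀ r₀ l ≤ σ * orient l₀ r₀ m)
    (hmr : σ * orient l₀ r₀ r ≤ σ * orient l₀ r₀ m) : 0 ≤ σ * orient l r m := by
  have key : (lin c r₀ - lin c l₀) * orient l r m =
      (lin c r - lin c m) * (orient l₀ r₀ m - orient l₀ r₀ l)
      + (lin c m - lin c l) * (orient l₀ r₀ m - orient l₀ r₀ r) := by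
    unfold lin orient; ring
  have h1 : 0 ≤ (lin c r₀ - lin c l₀) * (σ * orient l r m) := by
    have : (lin c r₀ - lin c l₀) * (σ * orient l r m) =
      (lin c r - lin c m) * (σ * orient l₀ r₀ m - σ * orient l₀ r₀ l)
      + (lin c m - lin c l) * (σ * orient l₀ r₀ m - σ * orient l₀ r₀ r) := by
      linear_combination σ * key
    rw [this]
    exact add_nonneg (mul_nonneg (sub_pos.2 hr).le (sub_nonneg.2 hml))
      (mul_nonneg (sub_pos.2 hl).le (sub_nonneg.2 hmr))
  exact nonneg_of_mul_nonneg_right h1 (sub_pos.2 h0)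

lemma ncard_isDel_le {P : Set Pt} (hfin : P.Finite) (hgp : GenPos P) (h3 : 3 ≤ P.ncard) :
    {t | IsDel P t}.ncard ≤ 2 * P.ncard - 5 := by
  obtain ⟨c, hc⟩ := exists_injOn_lin hfin
  set Q := hfin.toFinset with hQ
  have hQP : ∀ p, p ∈ Q ↔ p ∈ P := fun p => hfin.mem_toFinset
  have hcard : P.ncard = Q.card := ncard_eq_toFinset_card P hfin
  have hQne : Q.Nonempty := Finset.card_pos.1 (by omega)
  obtain ⟨l₀, hl₀, hmin⟩ := Finset.exists_min_image Q (lin c) hQne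
  obtain ⟨r₀, hr₀, hmax⟩ := Finset.exists_max_image Q (lin c) hQne
  have hlr : l₀ ≠ r₀ := by
    rintro rfl
    have : Q.card ≤ 1 := Finset.card_le_one.2 fun a ha b hb =>
      hc ((hQP a).1 ha) ((hQP b).1 hb) (le_antisymm ((hmax a ha).trans (hmin b hb))
        ((hmax b hb).trans (hmin a ha)))
    omega
  have hlt : lin c l₀ < lin c r₀ := (hmin r₀ hr₀).lt_of_ne fun h =>
    hlr (hc ((hQP _).1 hl₀) ((hQP _).1 hr₀) h)
  set M := (Q.erase l₀).erase r₀ with hM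
  have hMc : M.card = Q.card - 2 := by
    rw [hM, Finset.card_erase_of_mem (Finset.mem_erase.2 ⟨hlr.symm, hr₀⟩),
      Finset.card_erase_of_mem hl₀]
    omega
  have hMmem : ∀ p, p ∈ M ↔ p ≠ r₀ ∧ p ≠ l₀ ∧ p ∈ Q := fun p => by
    rw [hM, Finset.mem_erase, Finset.mem_erase]
  obtain ⟨p₀, hp₀⟩ : M.Nonempty := Finset.card_pos.1 (by omega)
  have hp₀' := (hMmem p₀).1 hp₀
  have hor := orient_ne_zero hgp ((hQP _).1 hl₀) ((hQP _).1 hr₀) ((hQP _).1 hp₀'.2.2) hlr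
    hp₀'.2.1.symm hp₀'.1.symm
  obtain ⟨σ, hσ, hσp⟩ : ∃ σ : ℝ, σ ∈ ({1, -1} : Finset ℝ) ∧ 0 < σ * orient l₀ r₀ p₀ := by
    rcases hor.lt_or_gt with h | h
    · exact ⟨-1, by simp, by linarith⟩
    · exact ⟨1, by simp, by linarith⟩
  obtain ⟨m₀, hm₀, hm₀max⟩ := Finset.exists_max_image Q (fun p => σ * orient l₀ r₀ p) hQne
  have hm₀pos : 0 < σ * orient l₀ r₀ m₀ := hσp.trans_le (hm₀max p₀ hp₀'.2.2)
  have hm₀M : m₀ ∈ M := by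
    refine (hMmem m₀).2 ⟨?_, ?_, hm₀⟩
    · rintro rfl
      have : orient l₀ m₀ m₀ = 0 := by unfold orient; ring
      rw [this, mul_zero] at hm₀pos
      exact hm₀pos.false
    · rintro rfl
      have : orient m₀ r₀ m₀ = 0 := by unfold orient; ring
      rw [this, mul_zero] at hm₀pos
      exact hm₀pos.false
  set B : Finset (Pt × ℝ) := (M ×ˢ ({1, -1} : Finset ℝ)).erase (m₀, -σ) with hB
  have hσ' : -σ ∈ ({1, -1} : Finset ℝ) := by
    simp only [Finset.mem_insert, Finset.mem_singleton] at hσ ⊢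
    rcases hσ with rfl | rfl <;> simp
  have hBc : B.card = 2 * P.ncard - 5 := by
    rw [hB, Finset.card_erase_of_mem (Finset.mem_product.2 ⟨hm₀M, hσ'⟩), Finset.card_product,
      Finset.card_pair (by norm_num), hMc, hcard]
    omega
  rw [ncard_eq_toFinset_card _ (finite_isDel hfin), ← hBc]
  refine Finset.card_le_card_of_forall_subsingleton (HasMid c) (fun t ht => ?_)
    fun q _ t ht s hs => ?_
  · have ht' : IsDel P t := by simpa using ht
    obtain ⟨l, m, r, htu, hl, hr⟩ := exists_sorted ht'.1 (hc.mono ht'.2.1)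
    have hlP : l ∈ P := ht'.2.1 (by simp [htu])
    have hmP : m ∈ P := ht'.2.1 (by simp [htu])
    have hrP : r ∈ P := ht'.2.1 (by simp [htu])
    have ho : orient l r m ≠ 0 := orient_ne_zero hgp hlP hrP hmP
      (fun h => (h ▸ hl.trans hr).false) (fun h => (h ▸ hl).false) (fun h => (h ▸ hr).false)
    obtain ⟨τ, hτ, hτp⟩ : ∃ τ : ℝ, τ ∈ ({1, -1} : Finset ℝ) ∧ 0 < τ * orient l r m := by
      rcases ho.lt_or_gt with h | h
      · exact ⟨-1, by simp, by linarith⟩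
      · exact ⟨1, by simp, by linarith⟩
    refine ⟨(m, τ), Finset.mem_erase.2 ⟨fun h => ?_, Finset.mem_product.2 ⟨(hMmem m).2
      ⟨?_, ?_, (hQP m).2 hmP⟩, hτ⟩⟩, l, r, htu, hl, hr, hτp⟩
    · obtain ⟨rfl, rfl⟩ := Prod.mk.inj h
      have := orient_nonpos_of_extreme hlt hl hr (hm₀max l ((hQP l).2 hlP))
        (hm₀max r ((hQP r).2 hrP))
      linarith
    · rintro rfl
      exact (hmax r ((hQP r).2 hrP)).not_gt hr
    · rintro rfl
      exact (hmin l ((hQP l).2 hlP)).not_gt hl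
  · have h1 : IsDel P t := by simpa using ht.1
    have h2 : IsDel P s := by simpa using hs.1
    exact h1.eq_of_hasMid hgp h2 ht.2 hs.2

lemma pw_segment_le (c : ℝ × ℝ × ℝ) (a b : Pt) {τ : ℝ} (h0 : 0 ≤ τ) (h1 : τ ≤ 1) :
    pw c ((1 - τ) • a + τ • b) ≤ (1 - τ) * pw c a + τ * pw c b := by
  have h : Bary a b b ((1 - τ) • a + τ • b) (1 - τ) τ 0 :=
    ⟨by simp, by simp, by ring⟩
  have := h.pw_le c (by linarith) h0 le_rfl
  linarith

lemma Bary.segment {u v w p p' : Pt} {α β γ α' β' γ' : ℝ} (h : Bary u v w p α β γ)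
    (h' : Bary u v w p' α' β' γ') (τ : ℝ) :
    Bary u v w ((1 - τ) • p + τ • p') ((1 - τ) * α + τ * α') ((1 - τ) * β + τ * β')
      ((1 - τ) * γ + τ * γ') := by
  refine ⟨?_, ?_, ?_⟩
  · simp [h.x, h'.x]; ring
  · simp [h.y, h'.y]; ring
  · linear_combination (1 - τ) * h.sum + τ * h'.sum

lemma Bary.self_left (u v w : Pt) : Bary u v w u 1 0 0 := ⟨by simp, by simp, by simp⟩

/-- A chord of a disk through a point of the segment `x y`, where `x` and `y` are not inside the
disk, is contained in this segment. -/
lemma Bary.nonneg_of_chord {c : ℝ × ℝ × ℝ} {q x y w w₀ : Pt} {β γ β₀ γ₀ : ℝ}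
    (hw : Bary q x y w 0 β γ) (hw₀ : Bary q x y w₀ 0 β₀ γ₀) (hy : 0 ≤ pw c y)
    (hβ₀ : 0 ≤ β₀) (h : pw c w < 0) (h₀ : pw c w₀ < 0) : 0 ≤ β := by
  by_contra! hneg
  have hd : 0 < β₀ - β := by linarith
  have e1 := hw.sum
  have e2 := hw₀.sum
  obtain rfl : γ = 1 - β := by linarith
  obtain rfl : γ₀ = 1 - β₀ := by linarith
  have hb : Bary w w₀ w₀ y (β₀ / (β₀ - β)) (-β / (β₀ - β)) 0 := by
    refine ⟨?_, ?_, ?_⟩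
    · rw [hw.x, hw₀.x]; field_simp; ring
    · rw [hw.y, hw₀.y]; field_simp; ring
    · field_simp; ring
  have h1 : 0 ≤ β₀ / (β₀ - β) := by positivity
  have h2 : 0 < -β / (β₀ - β) := div_pos (by linarith) hd
  have h3 := hb.pw_le c h1 h2.le le_rfl
  have h4 := mul_nonpos_of_nonneg_of_nonpos h1 h.le
  have h5 := mul_neg_of_pos_of_neg h2 h₀
  linarith

lemma IsOrderDT.exists_circle {P : Set Pt} {T : Set (Finset Pt)} (hT : IsOrderDT P 1 T)
    {t : Finset Pt} (ht : t ∈ T) : ∃ c, (∀ p ∈ t, pw c p = 0) ∧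
      ∀ p ∈ P, ∀ p' ∈ P, pw c p < 0 → pw c p' < 0 → p = p' := by
  have hne : t.Nonempty := Finset.card_pos.1 (by rw [(hT.1.2.1 t ht).1]; norm_num)
  obtain ⟨c, h1, h2⟩ := (orderKTri_iff hne).1 (hT.2 t ht)
  refine ⟨c, h1, fun p hp p' hp' h h' => ?_⟩
  rw [Nat.cast_one, encard_le_one_iff] at h2
  exact h2 p p' ⟨hp, h⟩ ⟨hp', h'⟩

set_option maxHeartbeats 400000 in
/-- In an order-1 Delaunay triangulation, if the circumdisk of the triangle `u v a` contains the
point `q` lying beyond the edge `u v`, then `u v q` is also a triangle. -/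
lemma IsOrderDT.opposite_mem {P : Set Pt} (hgp : GenPos P) {T : Set (Finset Pt)}
    (hT : IsOrderDT P 1 T) {u v a q : Pt} (huv : u ≠ v) (hua : u ≠ a) (hva : v ≠ a)
    (ht : {u, v, a} ∈ T) {c : ℝ × ℝ × ℝ} (hcu : pw c u = 0) (hcv : pw c v = 0) (hca : pw c a = 0)
    (hq : q ∈ P) (hcq : pw c q < 0) (huniq : ∀ p ∈ P, pw c p < 0 → p = q) {α β γ : ℝ}
    (hb : Bary u v a q α β γ) (hγ : γ < 0) : {u, v, q} ∈ T := by
  have htP := (hT.1.2.1 _ ht).2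
  have hu : u ∈ P := htP (by simp)
  have hv : v ∈ P := htP (by simp)
  have ha : a ∈ P := htP (by simp)
  have h0 := orient_ne_zero hgp hu hv ha huv hua hva
  have hβ : 0 < β := by
    by_contra! h
    exact (hb.pw_nonneg_of_cone hcu hcv hca h hγ.le).not_gt hcq
  have hα : 0 < α := by
    by_contra! h
    exact (hb.swap.pw_nonneg_of_cone hcv hcu hca h hγ.le).not_gt hcq
  have hout : ∀ p ∈ P, p ≠ q → 0 ≤ pw c p := fun p hp hpq => by
    by_contra! h
    exact hpq (huniq p hp h)
  have hqt : q ∉ ({u, v, a} : Finset Pt) := by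
    simp only [Finset.mem_insert, Finset.mem_singleton]
    rintro (rfl | rfl | rfl) <;> linarith
  obtain ⟨z, hz⟩ := exists_centroid u v a
  have hzint := mem_interior_triSet hz (by norm_num) (by norm_num) (by norm_num) h0
  have hzhull : z ∈ convexHull ℝ P := convexHull_mono htP (interior_subset hzint)
  have hcz : pw c z ≤ 0 := by
    have := hz.pw_le c (by norm_num) (by norm_num) (by norm_num)
    rw [hcu, hcv, hca] at this
    linarith
  obtain ⟨s, hs, hqs, ε, hε, hεs⟩ := hT.1.exists_mem_segment hgp hq hzhull
  have hsP := (hT.1.2.1 s hs).2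
  obtain ⟨x, y, rfl, hqx, hqy, hxy⟩ := exists_eq_triple_of_mem (hT.1.2.1 s hs).1 hqs
  have hx : x ∈ P := hsP (by simp)
  have hy : y ∈ P := hsP (by simp)
  have hnotin : ∀ w, w ∈ interior (triSet {u, v, a}) → w ∉ triSet {q, x, y} := fun w hw hws => by
    have := hT.1.eq_of_mem_interior hgp hs ht hw hws
    exact hqt (this ▸ hqs)
  have h1 := orient_ne_zero hgp hq hx hy hqx hqy hxy
  obtain ⟨ζ₀, l₀, m₀, hz'⟩ : ∃ ζ₀ l₀ m₀, Bary q x y z ζ₀ l₀ m₀ := ⟨_, _, _, exists_bary h1 z⟩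
  obtain ⟨hl₀, hm₀⟩ : 0 ≤ l₀ ∧ 0 ≤ m₀ := by
    obtain ⟨α', β', γ', -, hβ', hγ', hb'⟩ := mem_triSet.1 hεs
    have hcomb : q + ε • (z - q) = (1 - ε) • q + ε • z := by
      rw [smul_sub, sub_smul, one_smul]; abel
    have hb'' := (Bary.self_left q x y).segment hz' ε
    rw [hcomb] at hb'
    have e1 := mul_right_cancel₀ h1 (hb'.orient_mid.symm.trans hb''.orient_mid)
    have e2 := mul_right_cancel₀ h1 (hb'.orient_right.symm.trans hb''.orient_right)
    constructor
    · exact nonneg_of_mul_nonneg_right (by linarith : 0 ≤ ε * l₀) hε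
    · exact nonneg_of_mul_nonneg_right (by linarith : 0 ≤ ε * m₀) hε
  have hζ₀ : ζ₀ < 0 := by
    by_contra! h
    exact hnotin z hzint (mem_triSet.2 ⟨_, _, _, h, hl₀, hm₀, hz'⟩)
  have hcross : ∀ p : Pt, ∀ ζ l m : ℝ, Bary q x y p ζ l m → ζ < 0 → pw c p ≤ 0 →
      ∃ τ : ℝ, 0 < τ ∧ pw c ((1 - τ) • q + τ • p) < 0 ∧
        Bary q x y ((1 - τ) • q + τ • p) 0 (τ * l) (τ * m) := by
    intro p ζ l m hp hζ hcp
    have hd : 0 < 1 - ζ := by linarith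
    refine ⟨1 / (1 - ζ), by positivity, ?_, ?_⟩
    · have hlt : 1 / (1 - ζ) < 1 := by rw [div_lt_one hd]; linarith
      have hpos : 0 < 1 / (1 - ζ) := by positivity
      have := pw_segment_le c q p hpos.le hlt.le
      have i1 := mul_neg_of_pos_of_neg (sub_pos.2 hlt) hcq
      have i2 := mul_nonpos_of_nonneg_of_nonpos hpos.le hcp
      linarith
    · have := (Bary.self_left q x y).segment hp (1 / (1 - ζ))
      convert this using 1
      · field_simp; ring
      · ring
      · ring
  obtain ⟨τ₀, hτ₀, hw₀, hbw₀⟩ := hcross z ζ₀ l₀ m₀ hz' hζ₀ hcz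
  have hchord : ∀ w : Pt, ∀ l m : ℝ, Bary q x y w 0 l m → pw c w < 0 → 0 ≤ l ∧ 0 ≤ m := by
    intro w l m hw hcw
    refine ⟨hw.nonneg_of_chord hbw₀ (hout y hy hqy.symm) (by positivity) hcw hw₀, ?_⟩
    have hw' : Bary q y x w 0 m l := hw.rot.swap.rot.rot
    have hbw₀' : Bary q y x _ 0 _ _ := hbw₀.rot.swap.rot.rot
    exact hw'.nonneg_of_chord hbw₀' (hout x hx hqx.symm) (by positivity) hcw hw₀
  have hconv : Convex ℝ (triSet {u, v, a}) := convex_convexHull ℝ _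
  have hfar : ∀ p ∈ ({u, v, a} : Finset Pt), ∀ ζ l m : ℝ, Bary q x y p ζ l m → ζ ≤ 0 := by
    intro p hp ζ l m hbp
    by_contra! hζ
    have hcp : pw c p = 0 := by
      simp only [Finset.mem_insert, Finset.mem_singleton] at hp
      rcases hp with rfl | rfl | rfl <;> assumption
    have hd : 0 < ζ - ζ₀ := by linarith
    set τ := -ζ₀ / (ζ - ζ₀) with hτ
    have hτ0 : 0 < τ := div_pos (by linarith) hd
    have hτ1 : τ < 1 := by rw [hτ, div_lt_one hd]; linarith
    have hinterior : (1 - τ) • z + τ • p ∈ interior (triSet {u, v, a}) :=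
      hconv.combo_interior_self_mem_interior hzint (subset_convexHull ℝ _ hp) (sub_pos.2 hτ1)
        hτ0.le (by ring)
    have hcz' : pw c z < 0 := by
      have hz1 := hz.pw_eq' c
      rw [hcu, hcv, hca] at hz1
      have hne : 0 < (v 0 - u 0) ^ 2 + (v 1 - u 1) ^ 2 := by
        by_contra! hle
        refine huv (Pt.ext' ?_ ?_) <;>
          nlinarith [sq_nonneg (v 0 - u 0), sq_nonneg (v 1 - u 1)]
      nlinarith [sq_nonneg (a 0 - u 0), sq_nonneg (a 1 - u 1), sq_nonneg (v 0 - a 0),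
        sq_nonneg (v 1 - a 1)]
    have hcw : pw c ((1 - τ) • z + τ • p) < 0 := by
      have i1 := pw_segment_le c z p hτ0.le hτ1.le
      have i2 := mul_neg_of_pos_of_neg (sub_pos.2 hτ1) hcz'
      rw [hcp] at i1
      linarith
    have hbw := hz'.segment hbp τ
    have hzero : (1 - τ) * ζ₀ + τ * ζ = 0 := by rw [hτ]; field_simp; ring
    rw [hzero] at hbw
    obtain ⟨i1, i2⟩ := hchord _ _ _ hbw hcw
    exact hnotin _ hinterior (mem_triSet.2 ⟨_, _, _, le_rfl, i1, i2, hbw⟩)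
  obtain ⟨d, hd, hduniq⟩ := hT.exists_circle hs
  have hmain : ∀ p ∈ ({u, v, a} : Finset Pt), p ≠ x → p ≠ y → pw d p < 0 ∧
      ∃ ζ l m, Bary q x y p ζ l m ∧ ζ < 0 := by
    intro p hp hpx hpy
    have hcp : pw c p = 0 := by
      simp only [Finset.mem_insert, Finset.mem_singleton] at hp
      rcases hp with rfl | rfl | rfl <;> assumption
    obtain ⟨ζ, l, m, hbp⟩ : ∃ ζ l m, Bary q x y p ζ l m := ⟨_, _, _, exists_bary h1 p⟩
    have hne := orient_ne_zero hgp (htP hp) hx hy hpx hpy hxy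
    rw [hbp.orient_left] at hne
    have hζ := (hfar p hp ζ l m hbp).lt_of_ne (left_ne_zero_of_mul hne)
    obtain ⟨τ, hτ, hw, hbw⟩ := hcross p ζ l m hbp hζ hcp.le
    obtain ⟨i1, i2⟩ := hchord _ _ _ hbw hw
    have hl := nonneg_of_mul_nonneg_right i1 hτ
    have hm := nonneg_of_mul_nonneg_right i2 hτ
    have e := hbp.pw_sub c d
    rw [hd q (by simp), hd x (by simp), hd y (by simp), hcp] at e
    have j1 := mul_pos_of_neg_of_neg hζ hcq
    have j2 := mul_nonneg hl (hout x hx hqx.symm)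
    have j3 := mul_nonneg hm (hout y hy hqy.symm)
    exact ⟨by linarith, ζ, l, m, hbp, hζ⟩
  have hside_v : ¬ (v ≠ x ∧ v ≠ y ∧ ((x = u ∧ y = a) ∨ (x = a ∧ y = u))) := by
    rintro ⟨hvx, hvy, h⟩
    obtain ⟨-, ζ, l, m, hbp, hζ⟩ := hmain v (by simp) hvx hvy
    have e1 := hbp.orient_left
    have e2 := hb.orient_mid
    have hprod : ζ * β = 1 := by
      refine mul_right_cancel₀ h0 ?_
      rcases h with ⟨rfl, rfl⟩ | ⟨rfl, rfl⟩ <;> unfold orient at * <;>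
        first
        | linear_combination ζ * e2 + e1
        | linear_combination -(ζ * e2) - e1
        | linear_combination ζ * e2 - e1
        | linear_combination -(ζ * e2) + e1
    linarith [mul_neg_of_neg_of_pos hζ hβ]
  have hside_u : ¬ (u ≠ x ∧ u ≠ y ∧ ((x = v ∧ y = a) ∨ (x = a ∧ y = v))) := by
    rintro ⟨hux, huy, h⟩
    obtain ⟨-, ζ, l, m, hbp, hζ⟩ := hmain u (by simp) hux huy
    have e1 := hbp.orient_left
    have e2 := hb.orient_left
    have hprod : ζ * α = 1 := by
      refine mul_right_cancel₀ h0 ?_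
      rcases h with ⟨rfl, rfl⟩ | ⟨rfl, rfl⟩ <;> unfold orient at * <;>
        first
        | linear_combination ζ * e2 + e1
        | linear_combination -(ζ * e2) - e1
        | linear_combination ζ * e2 - e1
        | linear_combination -(ζ * e2) + e1
    linarith [mul_neg_of_neg_of_pos hζ hα]
  have hpair : ∀ p ∈ ({u, v, a} : Finset Pt), ∀ p' ∈ ({u, v, a} : Finset Pt), p ≠ p' →
      (p = x ∨ p = y) ∨ (p' = x ∨ p' = y) := by
    intro p hp p' hp' hne
    by_contra! hcon
    exact hne (hduniq p (htP hp) p' (htP hp') (hmain p hp hcon.1.1 hcon.1.2).1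
      (hmain p' hp' hcon.2.1 hcon.2.2).1)
  have huvp := hpair u (by simp) v (by simp) huv
  have huap := hpair u (by simp) a (by simp) hua
  have hvap := hpair v (by simp) a (by simp) hva
  have hgoal : (x = u ∧ y = v) ∨ (x = v ∧ y = u) := by grind
  rcases hgoal with ⟨rfl, rfl⟩ | ⟨rfl, rfl⟩
  · rwa [Finset.pair_comm, Finset.insert_comm]
  · rwa [Finset.pair_comm, Finset.insert_comm, Finset.pair_comm]

lemma exists_pw_neg {P : Set Pt} {u v w : Pt} (hu : u ∈ P) (hv : v ∈ P) (hw : w ∈ P)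
    (huv : u ≠ v) (huw : u ≠ w) (hvw : v ≠ w) (hN : ∀ t, IsDel P t → u ∈ t → v ∉ t)
    {c : ℝ × ℝ × ℝ} (hcu : pw c u = 0) (hcv : pw c v = 0) (hcw : pw c w = 0) :
    ∃ p ∈ P, pw c p < 0 := by
  by_contra! hcon
  refine hN {u, v, w} ⟨Finset.card_eq_three.2 ⟨u, v, w, huv, huw, hvw, rfl⟩, ?_, c, ?_, hcon⟩
    (by simp) (by simp)
  · simp [insert_subset_iff, hu, hv, hw]
  · simp [hcu, hcv, hcw]

/-- If `u v` is not a Delaunay edge and the circumdisk of a triangle `u v a` of an order-1 Delaunay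
triangulation contains `q`, then `q` is not beyond the side `u a`. -/
lemma IsOrderDT.bary_nonneg {P : Set Pt} (hgp : GenPos P) {T : Set (Finset Pt)}
    (hT : IsOrderDT P 1 T) {u v a q : Pt} (huv : u ≠ v) (hua : u ≠ a) (hva : v ≠ a)
    (ht : {u, v, a} ∈ T) {c : ℝ × ℝ × ℝ} (hcu : pw c u = 0) (hcv : pw c v = 0) (hca : pw c a = 0)
    (hq : q ∈ P) (hcq : pw c q < 0) (huniq : ∀ p ∈ P, pw c p < 0 → p = q) {α β γ : ℝ}
    (hb : Bary u v a q α β γ) (hN : ∀ t, IsDel P t → u ∈ t → v ∉ t) : 0 ≤ β := by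
  by_contra! hβ
  have htP := (hT.1.2.1 _ ht).2
  have hu : u ∈ P := htP (by simp)
  have hv : v ∈ P := htP (by simp)
  have huq : u ≠ q := by rintro rfl; exact hcq.ne hcu
  have hvq : v ≠ q := by rintro rfl; exact hcq.ne hcv
  have hs : {u, a, q} ∈ T := hT.opposite_mem hgp hua huv hva.symm
    (by rwa [Finset.pair_comm a v]) hcu hca hcv hq hcq huniq hb.swap.rot hβ
  obtain ⟨s, hs0, hsuniq⟩ := hT.exists_circle hs
  have hsv : pw s v < 0 := by
    have e := hb.pw_sub c s
    rw [hcu, hcv, hca, hs0 u (by simp), hs0 a (by simp), hs0 q (by simp)] at e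
    by_contra! h
    have := mul_nonpos_of_nonpos_of_nonneg hβ.le h
    linarith
  have h0 := orient_ne_zero hgp hu hv hq huv huq hvq
  obtain ⟨d, hdu, hdv, hdq⟩ := exists_pw_eq_zero h0
  obtain ⟨p, hp, hdp⟩ := exists_pw_neg hu hv hq huv huq hvq hN hdu hdv hdq
  have hpq : p ≠ q := by rintro rfl; exact hdp.ne hdq
  have hcp : 0 ≤ pw c p := by
    by_contra! h
    exact hpq (huniq p hp h)
  obtain ⟨α', β', γ', hb'⟩ : ∃ α' β' γ', Bary u v q p α' β' γ' := ⟨_, _, _, exists_bary h0 p⟩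
  have hγ' : γ' < 0 := by
    have e := hb'.pw_sub d c
    rw [hcu, hcv, hdu, hdv, hdq] at e
    by_contra! h
    have := mul_nonpos_of_nonneg_of_nonpos h hcq.le
    linarith
  have hβ' : 0 < β' := by
    by_contra! h
    exact (hb'.pw_nonneg_of_cone hdu hdv hdq h hγ'.le).not_gt hdp
  have hsp : pw s p < 0 := by
    have e := hb'.pw_sub d s
    rw [hdu, hdv, hdq, hs0 u (by simp), hs0 q (by simp)] at e
    have := mul_neg_of_pos_of_neg hβ' hsv
    linarith
  obtain rfl := hsuniq p hp v hv hsp hsv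
  exact hdp.ne hdv

/-- If the circumdisks of `u v a` and `u v' a` both contain `q` as their only point of `P`, and
`v` and `v'` lie on the same side of the line `u a`, then `v` and `v'` coincide. -/
lemma eq_of_circle {P : Set Pt} {u v v' a q : Pt} (hgp : GenPos P) (hu : u ∈ P) (hv : v ∈ P)
    (hv' : v' ∈ P) (ha : a ∈ P) (huv : u ≠ v) (hua : u ≠ a) (hva : v ≠ a) (hv'u : v' ≠ u)
    (hv'a : v' ≠ a) (hvq : v ≠ q) (hv'q : v' ≠ q) {c c' : ℝ × ℝ × ℝ}
    (hcu : pw c u = 0) (hcv : pw c v = 0) (hca : pw c a = 0)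
    (hc : ∀ p ∈ P, pw c p < 0 ↔ p = q) (hcu' : pw c' u = 0) (hcv' : pw c' v' = 0)
    (hca' : pw c' a = 0) (hc' : ∀ p ∈ P, pw c' p < 0 ↔ p = q) {α β γ α' β' γ' : ℝ}
    (hb : Bary u v a q α β γ) (hβ : 0 < β) (hb' : Bary u v' a q α' β' γ') (hβ' : 0 < β') :
    v = v' := by
  by_contra! hne
  have h0 := orient_ne_zero hgp hu hv ha huv hua hva
  obtain ⟨k, l, m, hk⟩ : ∃ k l m, Bary u v a v' k l m := ⟨_, _, _, exists_bary h0 v'⟩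
  have hl : β' * l = β := by
    refine mul_right_cancel₀ h0 ?_
    rw [mul_assoc, ← hk.orient_mid, ← hb'.orient_mid, hb.orient_mid]
  have hl0 : 0 < l := by
    by_contra! h
    have := mul_nonpos_of_nonneg_of_nonpos hβ'.le h
    linarith
  have h1 : 0 ≤ pw c v' := by
    by_contra! h
    exact hv'q ((hc v' hv').1 h)
  have h2 : 0 ≤ pw c' v := by
    by_contra! h
    exact hvq ((hc' v hv).1 h)
  have e := hk.pw_sub c c'
  rw [hcu, hcv, hca, hcu', hcv', hca'] at e
  have := mul_nonneg hl0.le h2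
  exact pw_ne_zero hgp hu hv ha hv' huv hua hva hv'u hne.symm hv'a hcu hcv hca (by linarith)

/-- The points `u, a, v, q` form a convex quadrilateral with diagonal `u v`, and the circumdisks of
the two triangles `u v a` and `u v q` contain no other points of `P`. -/
structure Flip (P : Set Pt) (u v a q : Pt) : Prop where
  mem : u ∈ P ∧ v ∈ P ∧ a ∈ P ∧ q ∈ P
  ne : u ≠ v ∧ u ≠ a ∧ v ≠ a ∧ u ≠ q ∧ v ≠ q ∧ a ≠ q
  circle_left : ∃ c, pw c u = 0 ∧ pw c v = 0 ∧ pw c a = 0 ∧ ∀ p ∈ P, pw c p < 0 ↔ p = q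
  circle_right : ∃ c, pw c u = 0 ∧ pw c v = 0 ∧ pw c q = 0 ∧ ∀ p ∈ P, pw c p < 0 ↔ p = a
  bary : ∃ α β γ, Bary u v a q α β γ ∧ 0 < α ∧ 0 < β ∧ γ < 0

namespace Flip

variable {P : Set Pt} {u v v' a q : Pt}

lemma swap (h : Flip P u v a q) : Flip P v u a q := by
  obtain ⟨⟨m1, m2, m3, m4⟩, ⟨n1, n2, n3, n4, n5, n6⟩, ⟨c, c1, c2, c3, c4⟩, ⟨d, d1, d2, d3, d4⟩,
    ⟨α, β, γ, hb, hα, hβ, hγ⟩⟩ := h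
  exact ⟨⟨m2, m1, m3, m4⟩, ⟨n1.symm, n3, n2, n5, n4, n6⟩, ⟨c, c2, c1, c3, c4⟩,
    ⟨d, d2, d1, d3, d4⟩, ⟨β, α, γ, hb.swap, hβ, hα, hγ⟩⟩

lemma swap_apex (h : Flip P u v a q) : Flip P u v q a := by
  obtain ⟨⟨m1, m2, m3, m4⟩, ⟨n1, n2, n3, n4, n5, n6⟩, hc, hd,
    ⟨α, β, γ, hb, hα, hβ, hγ⟩⟩ := h
  refine ⟨⟨m1, m2, m4, m3⟩, ⟨n1, n4, n5, n2, n3, n6.symm⟩, hd, hc,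
    ⟨-α / γ, -β / γ, 1 / γ, ⟨?_, ?_, ?_⟩, div_pos_of_neg_of_neg (by linarith) hγ,
      div_pos_of_neg_of_neg (by linarith) hγ, one_div_neg.2 hγ⟩⟩
  · have := hγ.ne
    rw [hb.x]; field_simp; ring
  · have := hγ.ne
    rw [hb.y]; field_simp; ring
  · have := hγ.ne
    have := hb.sum
    field_simp; linarith

lemma isDel (hgp : GenPos P) (h : Flip P u v a q) : IsDel P {a, q, u} := by
  obtain ⟨⟨hu, hv, ha, hq⟩, ⟨-, hua, -, huq, -, haq⟩, ⟨c, hcu, -, hca, hc⟩,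
    ⟨d, hdu, -, hdq, hd⟩, -⟩ := h
  have h0 := orient_ne_zero hgp hu ha hq hua huq haq
  obtain ⟨e, heu, hea, heq⟩ := exists_pw_eq_zero h0
  refine ⟨Finset.card_eq_three.2 ⟨a, q, u, haq, hua.symm, huq.symm, rfl⟩, ?_, e, ?_, ?_⟩
  · simp [insert_subset_iff, hu, ha, hq]
  · simp [heu, hea, heq]
  · intro p hp
    by_contra! hep
    obtain ⟨α, β, γ, hb⟩ : ∃ α β γ, Bary u a q p α β γ := ⟨_, _, _, exists_bary h0 p⟩
    have e1 := hb.pw_sub c e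
    have e2 := hb.pw_sub d e
    rw [hcu, hca, heu, hea, heq] at e1
    rw [hdu, hdq, heu, hea, heq] at e2
    have hcq : pw c q < 0 := (hc q hq).2 rfl
    have hda : pw d a < 0 := (hd a ha).2 rfl
    have hγ : γ < 0 := by
      by_contra! h
      have := mul_nonpos_of_nonneg_of_nonpos h hcq.le
      obtain rfl := (hc p hp).1 (by linarith)
      exact hep.ne heq
    have hβ : β < 0 := by
      by_contra! h
      have := mul_nonpos_of_nonneg_of_nonpos h hda.le
      obtain rfl := (hd p hp).1 (by linarith)
      exact hep.ne hea
    exact (hb.pw_nonneg_of_cone heu hea heq hβ.le hγ.le).not_gt hep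

lemma eq_of_same_apex (hgp : GenPos P) (h : Flip P u v a q) (h' : Flip P u v' a q) : v = v' := by
  obtain ⟨⟨hu, hv, ha, -⟩, ⟨huv, hua, hva, -, hvq, -⟩, ⟨c, hcu, hcv, hca, hc⟩, -,
    ⟨_, _, _, hb, -, hβ, -⟩⟩ := h
  obtain ⟨⟨-, hv', -, -⟩, ⟨huv', -, hva', -, hvq', -⟩, ⟨c', hcu', hcv', hca', hc'⟩, -,
    ⟨_, _, _, hb', -, hβ', -⟩⟩ := h'
  exact eq_of_circle hgp hu hv hv' ha huv hua hva huv'.symm hva' hvq hvq' hcu hcv hca hc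
    hcu' hcv' hca' hc' hb hβ hb' hβ'

lemma not_rotate (hgp : GenPos P) (h : Flip P u v a q) : ¬ Flip P a v' q u := by
  intro h'
  have hvv : v = v' := by
    obtain ⟨⟨hu, hv, ha, -⟩, ⟨huv, hua, hva, -, hvq, -⟩, ⟨c, hcu, hcv, hca, hc⟩, -,
      ⟨_, _, _, hb, -, hβ, -⟩⟩ := h
    obtain ⟨⟨-, hv', -, -⟩, ⟨hav', -, hvq', -, hvu', -⟩, -, ⟨c', hca', hcv', hcu', hc'⟩,
      -⟩ := id h'
    obtain ⟨_, _, _, hb', -, hβ', -⟩ := h'.swap_apex.bary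
    exact eq_of_circle hgp hu hv hv' ha huv hua hva hvu' hav'.symm hvq hvq' hcu hcv hca hc
      hcu' hcv' hca' hc' hb hβ hb'.rot.swap hβ'
  subst hvv
  obtain ⟨⟨hu, hv, ha, -⟩, ⟨huv, hua, hva, -⟩, -, -, ⟨α, β, γ, hb, hα, -, -⟩⟩ := h
  obtain ⟨-, -, -, -, ⟨α', β', γ', hb', -, -, hγ'⟩⟩ := h'
  have h0 := orient_ne_zero hgp hu hv ha huv hua hva
  have e1 := hb.orient_left
  have e2 := hb'.orient_right
  have : γ' * α = 1 := by
    refine mul_right_cancel₀ h0 ?_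
    unfold orient at *
    linear_combination -γ' * e1 + e2
  linarith [mul_neg_of_neg_of_pos hγ' hα]

lemma edge_eq (hgp : GenPos P) {u' a' q' : Pt} (h : Flip P u v a q) (h' : Flip P u' v' a' q')
    (ht : ({a, q, u} : Finset Pt) = {a', q', u'}) : ({u, v} : Finset Pt) = {u', v'} := by
  have hne := h.ne
  have hne' := h'.ne
  have hm : ∀ p, (p = a ∨ p = q ∨ p = u) ↔ (p = a' ∨ p = q' ∨ p = u') := fun p => by
    simpa using Finset.ext_iff.1 ht p
  have hu' := (hm u').2 (by simp)
  have ha' := (hm a').2 (by simp)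
  have hq' := (hm q').2 (by simp)
  have hcases : u' = u ∧ (a' = a ∧ q' = q ∨ a' = q ∧ q' = a) ∨
      u' = a ∧ (a' = q ∧ q' = u ∨ a' = u ∧ q' = q) ∨
      u' = q ∧ (a' = a ∧ q' = u ∨ a' = u ∧ q' = a) := by grind
  rcases hcases with ⟨rfl, ⟨rfl, rfl⟩ | ⟨rfl, rfl⟩⟩ | ⟨rfl, ⟨rfl, rfl⟩ | ⟨rfl, rfl⟩⟩ |
    ⟨rfl, ⟨rfl, rfl⟩ | ⟨rfl, rfl⟩⟩
  · rw [h.eq_of_same_apex hgp h']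
  · rw [h.eq_of_same_apex hgp h'.swap_apex]
  · exact absurd h' (h.not_rotate hgp)
  · exact absurd h'.swap_apex (h.not_rotate hgp)
  · exact absurd h' (h.swap_apex.not_rotate hgp)
  · exact absurd h'.swap_apex (h.swap_apex.not_rotate hgp)

end Flip

lemma exists_flip {P : Set Pt} (hfin : P.Finite) (hgp : GenPos P) (h3 : 3 ≤ P.ncard) {u v : Pt}
    (huv : u ≠ v) (hU : UsefulEdge P 1 u v) (hD : ¬ DelaunayEdge P u v) :
    ∃ a q, Flip P u v a q := by
  have hN : ∀ t, IsDel P t → u ∈ t → v ∉ t := fun t ht hut hvt =>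
    hD ⟨_, isOrderDT_isDel hfin hgp h3, t, ht, hut, hvt⟩
  obtain ⟨T, hT, t, ht, hut, hvt⟩ := hU
  obtain ⟨a, rfl, hua, hva⟩ := exists_eq_triple_of_mem_of_mem (hT.1.2.1 t ht).1 hut hvt huv
  have htP := (hT.1.2.1 _ ht).2
  have hu : u ∈ P := htP (by simp)
  have hv : v ∈ P := htP (by simp)
  have ha : a ∈ P := htP (by simp)
  obtain ⟨c, hc0, hcuniq⟩ := hT.exists_circle ht
  have hcu := hc0 u (by simp)
  have hcv := hc0 v (by simp)
  have hca := hc0 a (by simp)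
  obtain ⟨q, hq, hcq⟩ := exists_pw_neg hu hv ha huv hua hva hN hcu hcv hca
  have huniq : ∀ p ∈ P, pw c p < 0 → p = q := fun p hp h => hcuniq p hp q hq h hcq
  have hqne : ∀ p, pw c p = 0 → p ≠ q := by rintro p hp rfl; exact hcq.ne hp
  have h0 := orient_ne_zero hgp hu hv ha huv hua hva
  obtain ⟨α, β, γ, hb⟩ : ∃ α β γ, Bary u v a q α β γ := ⟨_, _, _, exists_bary h0 q⟩
  have hβ := hT.bary_nonneg hgp huv hua hva ht hcu hcv hca hq hcq huniq hb hN
  have hα := hT.bary_nonneg hgp huv.symm hva hua (by rwa [Finset.insert_comm]) hcv hcu hca hq hcq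
    huniq hb.swap fun t ht h h' => hN t ht h' h
  have hγ : γ < 0 := by
    by_contra! h
    exact hcq.ne (hc0 q (hT.1.mem_of_mem_triSet hgp ht hq (mem_triSet.2 ⟨_, _, _, hα, hβ, h, hb⟩)))
  obtain ⟨d, hd0, hduniq⟩ := hT.exists_circle
    (hT.opposite_mem hgp huv hua hva ht hcu hcv hca hq hcq huniq hb hγ)
  have hdu := hd0 u (by simp)
  have hdv := hd0 v (by simp)
  have hdq := hd0 q (by simp)
  have hda : pw d a < 0 := by
    have e := hb.pw_sub c d
    rw [hcu, hcv, hca, hdu, hdv, hdq] at e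
    by_contra! h
    have := mul_nonpos_of_nonpos_of_nonneg hγ.le h
    linarith
  refine ⟨a, q, ⟨hu, hv, ha, hq⟩, ⟨huv, hua, hva, hqne u hcu, hqne v hcv, hqne a hca⟩,
    ⟨c, hcu, hcv, hca, fun p hp => ⟨huniq p hp, ?_⟩⟩,
    ⟨d, hdu, hdv, hdq, fun p hp => ⟨fun h => hduniq p hp a ha h hda, ?_⟩⟩,
    ⟨α, β, γ, hb, ?_, ?_, hγ⟩⟩
  · rintro rfl; exact hcq
  · rintro rfl; exact hda
  · by_contra! h
    exact (hb.swap.pw_nonneg_of_cone hcv hcu hca h hγ.le).not_gt hcq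
  · by_contra! h
    exact (hb.pw_nonneg_of_cone hcu hcv hca h hγ.le).not_gt hcq

lemma two_mul_ncard_usefulNotDel_le {P : Set Pt} (hfin : P.Finite) (hgp : GenPos P)
    (h3 : 3 ≤ P.ncard) : (usefulNotDel P).ncard * 2 ≤ {t | IsDel P t}.ncard := by
  classical
  have hE : (usefulNotDel P).Finite := by
    refine (hfin.toFinset.powerset.finite_toSet).subset ?_
    rintro e ⟨u, v, hu, hv, -, rfl, -⟩
    simp [insert_subset_iff, hu, hv]
  have hD := finite_isDel hfin
  rw [ncard_eq_toFinset_card _ hE, ncard_eq_toFinset_card _ hD,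
    ← mul_one hD.toFinset.card]
  refine Finset.card_mul_le_card_mul
    (fun e t => ∃ u v a q, Flip P u v a q ∧ e = {u, v} ∧ t = {a, q, u}) ?_ ?_
  · intro e he
    obtain ⟨u, v, hu, hv, huv, rfl, hU, hnD⟩ := hE.mem_toFinset.1 he
    obtain ⟨a, q, h⟩ := exists_flip hfin hgp h3 huv hU hnD
    have hne : ({a, q, u} : Finset Pt) ≠ {a, q, v} := fun heq => by
      have := Finset.ext_iff.1 heq u
      simp [huv, h.ne.2.1, h.ne.2.2.2.1] at this
    rw [← Finset.card_pair hne]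
    refine Finset.card_le_card fun t ht => ?_
    rw [Finset.mem_bipartiteAbove, hD.mem_toFinset]
    simp only [Finset.mem_insert, Finset.mem_singleton] at ht
    rcases ht with rfl | rfl
    · exact ⟨h.isDel hgp, u, v, a, q, h, rfl, rfl⟩
    · exact ⟨h.swap.isDel hgp, v, u, a, q, h.swap, Finset.pair_comm _ _, rfl⟩
  · intro t _
    refine Finset.card_le_one.2 fun e he e' he' => ?_
    rw [Finset.mem_bipartiteBelow] at he he'
    obtain ⟨-, u, v, a, q, h, rfl, rfl⟩ := he
    obtain ⟨-, u', v', a', q', h', rfl, ht⟩ := he'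
    exact h.edge_eq hgp h' ht

/-- Every set of `n ≥ 3` points in general position has at most `n - 3` useful order-1
non-Delaunay edges (flippable quadrilaterals). -/
theorem useful_not_delaunay_edges_le
    (P : Set Pt) (hfin : P.Finite) (hgp : GenPos P)
    (n : ℕ) (hn : 3 ≤ n) (hcard : P.ncard = n) :
    (usefulNotDel P).ncard ≤ n - 3 := by
  subst hcard
  have h1 := two_mul_ncard_usefulNotDel_le hfin hgp hn
  have h2 := ncard_isDel_le hfin hgp hn
  omega

end
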